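/- arXiv:1604.02339 — 7 statements merged into one kernel-verified Lean document; each statement's English description precedes it below -/
import Mathlib

section
/- Let n ≥ 1, let V : ℝ × ℝⁿ → ℝⁿ and a, b : ℝ × ℝⁿ → ℝ be continuously differentiable, and suppose that at every point (t,x): ∂ₜa + div(aV) = 0, ∂ₜb + div(bV) = 0, and b(t,x) ≠ 0. Then the ratio ϑ := a/b satisfies the advection equation ∂ₜϑ + ⟨V, ∇ϑ⟩ = 0 at every point (t,x). -/
noncomputable section

/-- Euclidean inner product on ℝⁿ. -/
def dotn {n : ℕ} (u v : Fin n → ℝ) : ℝ := ∑ i, u i * v i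

/-- Partial derivative ∂ᵢ of a scalar field on ℝⁿ. -/
def pdn {n : ℕ} (i : Fin n) (f : (Fin n → ℝ) → ℝ) (x : Fin n → ℝ) : ℝ :=
  fderiv ℝ f x (Pi.single i 1)

/-- Gradient of a scalar field on ℝⁿ. -/
def gradn {n : ℕ} (f : (Fin n → ℝ) → ℝ) (x : Fin n → ℝ) : Fin n → ℝ := fun i => pdn i f x

/-- Divergence of a vector field on ℝⁿ. -/
def divn {n : ℕ} (V : (Fin n → ℝ) → (Fin n → ℝ)) (x : Fin n → ℝ) : ℝ :=
  ∑ i, pdn i (fun y => V y i) x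

theorem pdn_mul {n : ℕ} {f g : (Fin n → ℝ) → ℝ} {x : Fin n → ℝ} (i : Fin n)
    (hf : DifferentiableAt ℝ f x) (hg : DifferentiableAt ℝ g x) :
    pdn i (fun y => f y * g y) x = f x * pdn i g x + g x * pdn i f x := by
  simp [pdn, fderiv_fun_mul hf hg]

theorem divn_smul {n : ℕ} {f : (Fin n → ℝ) → ℝ} {W : (Fin n → ℝ) → (Fin n → ℝ)}
    {x : Fin n → ℝ} (hf : DifferentiableAt ℝ f x) (hW : DifferentiableAt ℝ W x) :
    divn (fun y => f y • W y) x = f x * divn W x + dotn (W x) (gradn f x) := by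
  simp only [divn, dotn, gradn, Pi.smul_apply, smul_eq_mul, Finset.mul_sum,
    ← Finset.sum_add_distrib]
  exact Finset.sum_congr rfl fun i _ => pdn_mul i hf (differentiableAt_pi.1 hW i)

theorem dotn_smul_left {n : ℕ} (c : ℝ) (u v : Fin n → ℝ) :
    dotn (c • u) v = c * dotn u v := by
  simp [dotn, Finset.mul_sum, mul_assoc]

/-- Paper's Lemma 1 in Euclidean coordinates: if a and b both satisfy the
continuity equation with velocity V and b never vanishes, then ϑ = a/b is advected by V. -/
theorem ratio_advected (n : ℕ) (hn : 1 ≤ n)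
    (V : ℝ × (Fin n → ℝ) → (Fin n → ℝ)) (a b : ℝ × (Fin n → ℝ) → ℝ)
    (hV : ContDiff ℝ 1 V) (ha : ContDiff ℝ 1 a) (hb : ContDiff ℝ 1 b)
    (hconta : ∀ (t : ℝ) (x : Fin n → ℝ),
      deriv (fun s => a (s, x)) t + divn (fun y => a (t, y) • V (t, y)) x = 0)
    (hcontb : ∀ (t : ℝ) (x : Fin n → ℝ),
      deriv (fun s => b (s, x)) t + divn (fun y => b (t, y) • V (t, y)) x = 0)
    (hbne : ∀ (t : ℝ) (x : Fin n → ℝ), b (t, x) ≠ 0) :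
    ∀ (t : ℝ) (x : Fin n → ℝ),
      deriv (fun s => a (s, x) / b (s, x)) t
        + dotn (V (t, x)) (gradn (fun y => a (t, y) / b (t, y)) x) = 0 := by
  intro t x
  have hVd := hV.differentiable one_ne_zero
  have had := ha.differentiable one_ne_zero
  have hbd := hb.differentiable one_ne_zero
  have hbt : DifferentiableAt ℝ (fun s => b (s, x)) t := by fun_prop
  have hθt : DifferentiableAt ℝ (fun s => a (s, x) / b (s, x)) t := by
    fun_prop (disch := exact hbne _ _)
  have hθx : DifferentiableAt ℝ (fun y => a (t, y) / b (t, y)) x := by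
    fun_prop (disch := exact hbne _ _)
  have hbV : DifferentiableAt ℝ (fun y => b (t, y) • V (t, y)) x := by fun_prop
  have htime : deriv (fun s => a (s, x)) t =
      deriv (fun s => a (s, x) / b (s, x)) t * b (t, x)
        + a (t, x) / b (t, x) * deriv (fun s => b (s, x)) t := by
    rw [← deriv_fun_mul hθt hbt]
    simp only [div_mul_cancel₀ _ (hbne _ _)]
  have hspace : divn (fun y => a (t, y) • V (t, y)) x =
      a (t, x) / b (t, x) * divn (fun y => b (t, y) • V (t, y)) x
        + b (t, x) * dotn (V (t, x)) (gradn (fun y => a (t, y) / b (t, y)) x) := by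
    rw [← dotn_smul_left, ← divn_smul hθx hbV]
    simp only [smul_smul, div_mul_cancel₀ _ (hbne _ _)]
  refine (mul_eq_zero.1 ?_).resolve_left (hbne t x)
  linear_combination hconta t x - a (t, x) / b (t, x) * hcontb t x - htime - hspace
end
end

section
/- For twice continuously differentiable functions φ, p, q : ℝ³ → ℝ and V := ∇φ + p·∇q, the helicity density is an exact divergence: ⟨V, curl V⟩ = div(φ·(∇p × ∇q)) at every point. (This expresses ℘ ∧ d℘ = d(φ dp ∧ dq) for the Clebsch 1-form ℘ = dφ + p dq.) -/
open MeasureTheory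

noncomputable section

/-- Points of ℝ³. -/
abbrev R3 := Fin 3 → ℝ

/-- Euclidean inner product on ℝ³. -/
def dot3 (u v : R3) : ℝ := ∑ i, u i * v i

/-- Partial derivative ∂ᵢ of a scalar field on ℝ³. -/
def pd3 (i : Fin 3) (f : R3 → ℝ) (x : R3) : ℝ := fderiv ℝ f x (Pi.single i 1)

/-- Gradient of a scalar field on ℝ³. -/
def grad3 (f : R3 → ℝ) (x : R3) : R3 := fun i => pd3 i f x

/-- Divergence of a vector field on ℝ³. -/
def div3 (V : R3 → R3) (x : R3) : ℝ := ∑ i, pd3 i (fun y => V y i) x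

/-- Curl of a vector field on ℝ³ (0-based indices). -/
def curl3 (V : R3 → R3) (x : R3) : R3 :=
  ![pd3 1 (fun y => V y 2) x - pd3 2 (fun y => V y 1) x,
    pd3 2 (fun y => V y 0) x - pd3 0 (fun y => V y 2) x,
    pd3 0 (fun y => V y 1) x - pd3 1 (fun y => V y 0) x]

/-- Cross product on ℝ³. -/
def cross3 (u v : R3) : R3 :=
  ![u 1 * v 2 - u 2 * v 1, u 2 * v 0 - u 0 * v 2, u 0 * v 1 - u 1 * v 0]

/-- Determinant of the 3×3 matrix with columns u, v, w. -/
def det3 (u v w : R3) : ℝ := Matrix.det (Matrix.transpose (Matrix.of ![u, v, w]))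

theorem pd3_add {f g : R3 → ℝ} {x : R3} (i : Fin 3) (hf : DifferentiableAt ℝ f x)
    (hg : DifferentiableAt ℝ g x) :
    pd3 i (fun y => f y + g y) x = pd3 i f x + pd3 i g x := by
  simp [pd3, fderiv_fun_add hf hg]

theorem pd3_sub {f g : R3 → ℝ} {x : R3} (i : Fin 3) (hf : DifferentiableAt ℝ f x)
    (hg : DifferentiableAt ℝ g x) :
    pd3 i (fun y => f y - g y) x = pd3 i f x - pd3 i g x := by
  simp [pd3, fderiv_fun_sub hf hg]

theorem pd3_mul {f g : R3 → ℝ} {x : R3} (i : Fin 3) (hf : DifferentiableAt ℝ f x)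
    (hg : DifferentiableAt ℝ g x) :
    pd3 i (fun y => f y * g y) x = f x * pd3 i g x + g x * pd3 i f x := by
  simp [pd3, fderiv_fun_mul hf hg]

theorem differentiable_pd3 {f : R3 → ℝ} (hf : ContDiff ℝ 2 f) (i : Fin 3) :
    Differentiable ℝ (pd3 i f) := by
  have h : Differentiable ℝ (fderiv ℝ f) :=
    (hf.fderiv_right (m := 1) (by norm_num)).differentiable (by norm_num)
  unfold pd3
  fun_prop

/-- Equality of mixed second partial derivatives. -/
theorem pd3_comm {f : R3 → ℝ} (hf : ContDiff ℝ 2 f) (i j : Fin 3) (x : R3) :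
    pd3 i (pd3 j f) x = pd3 j (pd3 i f) x := by
  have h : DifferentiableAt ℝ (fderiv ℝ f) x :=
    (hf.fderiv_right (m := 1) (by norm_num)).differentiable (by norm_num) x
  have key (k l : Fin 3) : pd3 k (pd3 l f) x =
      fderiv ℝ (fderiv ℝ f) x (Pi.single k 1) (Pi.single l 1) := by
    unfold pd3
    rw [fderiv_clm_apply h (differentiableAt_const _)]
    simp
  rw [key, key]
  exact (hf.contDiffAt.isSymmSndFDerivAt (by simp)) _ _

/-- The helicity density of an epi-2D flow V = ∇φ + p·∇q is the exact
divergence div(φ·(∇p × ∇q)), i.e. ℘ ∧ d℘ = d(φ dp ∧ dq). -/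
theorem helicity_density_exact (φ p q : R3 → ℝ)
    (hφ : ContDiff ℝ 2 φ) (hp : ContDiff ℝ 2 p) (hq : ContDiff ℝ 2 q) :
    ∀ x : R3,
      dot3 (grad3 φ x + p x • grad3 q x)
           (curl3 (fun y => grad3 φ y + p y • grad3 q y) x)
        = div3 (fun y => φ y • cross3 (grad3 p y) (grad3 q y)) x := by
  intro x
  have dφ : DifferentiableAt ℝ φ x := hφ.differentiable (by norm_num) x
  have dp : DifferentiableAt ℝ p x := hp.differentiable (by norm_num) x
  have dφ' (i : Fin 3) := differentiable_pd3 hφ i x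
  have dp' (i : Fin 3) := differentiable_pd3 hp i x
  have dq' (i : Fin 3) := differentiable_pd3 hq i x
  have pd3_flow (i j : Fin 3) :
      pd3 i (fun y => pd3 j φ y + p y * pd3 j q y) x =
        pd3 i (pd3 j φ) x + (p x * pd3 i (pd3 j q) x + pd3 j q x * pd3 i p x) := by
    rw [pd3_add i (dφ' j) (dp.fun_mul (dq' j)), pd3_mul i dp (dq' j)]
  have pd3_flux (i j k : Fin 3) :
      pd3 i (fun y => φ y * (pd3 j p y * pd3 k q y - pd3 k p y * pd3 j q y)) x =
        φ x * ((pd3 j p x * pd3 i (pd3 k q) x + pd3 k q x * pd3 i (pd3 j p) x)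
          - (pd3 k p x * pd3 i (pd3 j q) x + pd3 j q x * pd3 i (pd3 k p) x))
        + (pd3 j p x * pd3 k q x - pd3 k p x * pd3 j q x) * pd3 i φ x := by
    have h₁ := (dp' j).fun_mul (dq' k)
    have h₂ := (dp' k).fun_mul (dq' j)
    rw [pd3_mul i dφ (h₁.fun_sub h₂), pd3_sub i h₁ h₂, pd3_mul i (dp' j) (dq' k),
      pd3_mul i (dp' k) (dq' j)]
  simp only [dot3, div3, curl3, cross3, grad3, Fin.sum_univ_three, Pi.add_apply, Pi.smul_apply,
    smul_eq_mul, Matrix.cons_val, pd3_flow, pd3_flux]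
  rw [pd3_comm hφ 1 0, pd3_comm hφ 2 0, pd3_comm hφ 2 1, pd3_comm hp 1 0, pd3_comm hp 2 0,
    pd3_comm hp 2 1, pd3_comm hq 1 0, pd3_comm hq 2 0, pd3_comm hq 2 1]
  ring
end
end

section
/- Let p, q : ℝ³ → ℝ be continuously differentiable and set ω := ∇p × ∇q (the vorticity of an epi-2D flow). If x : ℝ → ℝ³ is differentiable and satisfies the vortex-line equation x'(τ) = ω(x(τ)) for all τ, then the functions τ ↦ p(x(τ)) and τ ↦ q(x(τ)) are constant; i.e., every vortex line stays on the intersection of a level set of p with a level set of q. (Paper's Proposition 2: the vortex line equation of epi-2D flow is integrable, with integral surfaces given by the Clebsch parameters p and q.) -/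
open MeasureTheory

noncomputable section

theorem fderiv_apply_eq_dot3_grad3 (f : R3 → ℝ) (y v : R3) :
    fderiv ℝ f y v = dot3 (grad3 f y) v := by
  conv_lhs => rw [← Finset.univ_sum_single v, map_sum]
  refine Finset.sum_congr rfl fun i _ => ?_
  rw [show (Pi.single i (v i) : R3) = v i • Pi.single i 1 by
    rw [← Pi.single_smul, smul_eq_mul, mul_one], map_smul, smul_eq_mul, mul_comm]
  rfl

theorem dot3_cross3_left (u v : R3) : dot3 u (cross3 u v) = 0 := by
  simp [dot3, cross3, Fin.sum_univ_three]
  ring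

theorem dot3_cross3_right (u v : R3) : dot3 v (cross3 u v) = 0 := by
  simp [dot3, cross3, Fin.sum_univ_three]
  ring

/-- A differentiable field is constant along any curve whose velocity is everywhere orthogonal
to its gradient. -/
theorem eq_along_curve_of_dot3_grad3_eq_zero {f : R3 → ℝ} (hf : Differentiable ℝ f)
    {x : ℝ → R3} (hx : Differentiable ℝ x)
    (h : ∀ τ, dot3 (grad3 f (x τ)) (deriv x τ) = 0) (τ₁ τ₂ : ℝ) : f (x τ₁) = f (x τ₂) := by
  refine is_const_of_deriv_eq_zero (f := f ∘ x) (hf.comp hx) (fun τ => ?_) τ₁ τ₂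
  rw [fderiv_comp_deriv τ (hf _) (hx _), fderiv_apply_eq_dot3_grad3, h]

/-- Paper's Proposition 2: vortex lines of an epi-2D flow, i.e. integral
curves of ω = ∇p × ∇q, stay on the level sets of the Clebsch parameters p and q. -/
theorem vortex_line_integrable (p q : R3 → ℝ)
    (hp : ContDiff ℝ 1 p) (hq : ContDiff ℝ 1 q)
    (x : ℝ → R3) (hx : Differentiable ℝ x)
    (hline : ∀ τ : ℝ, deriv x τ = cross3 (grad3 p (x τ)) (grad3 q (x τ))) :
    (∀ τ₁ τ₂ : ℝ, p (x τ₁) = p (x τ₂)) ∧ (∀ τ₁ τ₂ : ℝ, q (x τ₁) = q (x τ₂)) := by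
  exact ⟨eq_along_curve_of_dot3_grad3_eq_zero (hp.differentiable one_ne_zero) hx fun τ => by
      rw [hline, dot3_cross3_left],
    eq_along_curve_of_dot3_grad3_eq_zero (hq.differentiable one_ne_zero) hx fun τ => by
      rw [hline, dot3_cross3_right]⟩
end
end

section
/- Let V : ℝ × ℝ³ → ℝ³ be continuously differentiable and let p, q, r : ℝ × ℝ³ → ℝ be twice continuously differentiable, each advected by V, i.e. ∂ₜp + ⟨V, ∇p⟩ = 0, ∂ₜq + ⟨V, ∇q⟩ = 0, ∂ₜr + ⟨V, ∇r⟩ = 0 at every (t,x). Then the Jacobian determinant w(t,x) := det[∇p(t,x) | ∇q(t,x) | ∇r(t,x)] (the density of the 3-form dp ∧ dq ∧ dr) satisfies the continuity equation ∂ₜw + div(wV) = 0 at every (t,x). -/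
open MeasureTheory

noncomputable section

/-- The `i`-th spatial basis vector of space-time. -/
def spatialDir (i : Fin 3) : ℝ × R3 := (0, Pi.single i 1)

lemma pd3_slice {f : ℝ × R3 → ℝ} {t : ℝ} {x : R3} (hf : DifferentiableAt ℝ f (t, x))
    (i : Fin 3) : pd3 i (fun y => f (t, y)) x = fderiv ℝ f (t, x) (spatialDir i) := by
  have h := hf.hasFDerivAt.comp x (hasFDerivAt_prodMk_right (𝕜 := ℝ) t x)
  have h' : HasFDerivAt (fun y => f (t, y)) _ x := h
  simp [pd3, h'.fderiv, spatialDir]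

lemma deriv_slice {f : ℝ × R3 → ℝ} {t : ℝ} {x : R3} (hf : DifferentiableAt ℝ f (t, x)) :
    deriv (fun s => f (s, x)) t = fderiv ℝ f (t, x) (1, 0) := by
  have h := hf.hasFDerivAt.comp t (hasFDerivAt_prodMk_left (𝕜 := ℝ) t x)
  have h' : HasFDerivAt (fun s => f (s, x)) _ t := h
  simp [h'.hasDerivAt.deriv]

lemma grad3_slice {f : ℝ × R3 → ℝ} (hf : Differentiable ℝ f) (t : ℝ) (x : R3) :
    grad3 (fun y => f (t, y)) x = fun i => fderiv ℝ f (t, x) (spatialDir i) :=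
  funext fun i => pd3_slice (hf _) i

lemma det3_eq (u v w : R3) : det3 u v w =
    u 0 * (v 1 * w 2 - v 2 * w 1) + u 1 * (v 2 * w 0 - v 0 * w 2)
      + u 2 * (v 0 * w 1 - v 1 * w 0) := by
  simp [det3, Matrix.det_fin_three]
  ring

lemma hasFDerivAt_fderiv_apply {E : Type*} [NormedAddCommGroup E] [NormedSpace ℝ E]
    {f : E → ℝ} (hf : ContDiff ℝ 2 f) (z v : E) :
    HasFDerivAt (fun z => fderiv ℝ f z v) ((fderiv ℝ (fderiv ℝ f) z).flip v) z := by
  have h : DifferentiableAt ℝ (fderiv ℝ f) z :=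
    (hf.fderiv_right (m := 1) (by norm_num)).differentiable (by norm_num) z
  simpa using h.hasFDerivAt.clm_apply (hasFDerivAt_const v z)

lemma fderiv_fderiv_symm {E : Type*} [NormedAddCommGroup E] [NormedSpace ℝ E]
    {f : E → ℝ} (hf : ContDiff ℝ 2 f) (z u v : E) :
    fderiv ℝ (fderiv ℝ f) z u v = fderiv ℝ (fderiv ℝ f) z v u :=
  (hf.contDiffAt.isSymmSndFDerivAt (by simp)) u v

/-- The determinant is differentiated by the Leibniz rule in its three columns. -/
lemma hasFDerivAt_det3 {E : Type*} [NormedAddCommGroup E] [NormedSpace ℝ E]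
    {P Q R : E → R3} {P' Q' R' : Fin 3 → E →L[ℝ] ℝ} {z : E}
    (hP : ∀ i, HasFDerivAt (fun z => P z i) (P' i) z)
    (hQ : ∀ i, HasFDerivAt (fun z => Q z i) (Q' i) z)
    (hR : ∀ i, HasFDerivAt (fun z => R z i) (R' i) z) :
    ∃ L : E →L[ℝ] ℝ, HasFDerivAt (fun z => det3 (P z) (Q z) (R z)) L z ∧
      ∀ v, L v = det3 (fun i => P' i v) (Q z) (R z) + det3 (P z) (fun i => Q' i v) (R z)
        + det3 (P z) (Q z) (fun i => R' i v) := by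
  simp only [det3_eq]
  refine ⟨_, (((hP 0).mul (((hQ 1).mul (hR 2)).sub ((hQ 2).mul (hR 1)))).add
    ((hP 1).mul (((hQ 2).mul (hR 0)).sub ((hQ 0).mul (hR 2))))).add
    ((hP 2).mul (((hQ 0).mul (hR 1)).sub ((hQ 1).mul (hR 0)))), fun v => ?_⟩
  simp
  ring

/-- The spatial derivative of the advection equation. -/
lemma advected_fderiv {V : ℝ × R3 → R3} {p : ℝ × R3 → ℝ}
    (hV : Differentiable ℝ V) (hp : ContDiff ℝ 2 p)
    (hadv : ∀ (t : ℝ) (x : R3),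
      deriv (fun s => p (s, x)) t + dot3 (V (t, x)) (grad3 (fun y => p (t, y)) x) = 0)
    (z v : ℝ × R3) :
    fderiv ℝ (fderiv ℝ p) z (1, 0) v
      + ∑ i, (fderiv ℝ (fun z => V z i) z v * fderiv ℝ p z (spatialDir i)
        + V z i * fderiv ℝ (fderiv ℝ p) z (spatialDir i) v) = 0 := by
  have hpd : Differentiable ℝ p := hp.differentiable (by norm_num)
  have h0 : (fun z : ℝ × R3 => fderiv ℝ p z (1, 0)
      + ∑ i, V z i * fderiv ℝ p z (spatialDir i)) = fun _ => 0 := by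
    funext ⟨t, x⟩
    simpa only [deriv_slice (hpd _), grad3_slice hpd, dot3] using hadv t x
  have h1 := (hasFDerivAt_fderiv_apply hp z (1, 0)).add
    (HasFDerivAt.fun_sum (u := Finset.univ) fun i _ =>
      ((differentiableAt_pi.1 (hV z) i).hasFDerivAt.mul
        (hasFDerivAt_fderiv_apply hp z (spatialDir i))))
  have h2 : HasFDerivAt (fun _ : ℝ × R3 => (0 : ℝ)) _ z :=
    h1.congr_of_eventuallyEq (Filter.Eventually.of_forall fun y => by
      simpa using (congrFun h0 y).symm)
  have h3 := congrArg (fun L : (ℝ × R3) →L[ℝ] ℝ => L v) (h2.unique (hasFDerivAt_const 0 z))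
  simp only [Fin.sum_univ_three, add_apply, smul_apply, ContinuousLinearMap.flip_apply,
    zero_apply, smul_eq_mul] at h3
  rw [fderiv_fderiv_symm hp z (1, 0) v, Fin.sum_univ_three]
  simp only [fun i => fderiv_fderiv_symm hp z (spatialDir i) v]
  linear_combination h3

/-- if p, q, r are advected by V, then the Jacobian determinant
w = det[∇p | ∇q | ∇r] (density of dp ∧ dq ∧ dr) obeys the continuity equation. -/
theorem jacobian_continuity (V : ℝ × R3 → R3) (p q r : ℝ × R3 → ℝ)
    (hV : ContDiff ℝ 1 V) (hp : ContDiff ℝ 2 p) (hq : ContDiff ℝ 2 q) (hr : ContDiff ℝ 2 r)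
    (hadvp : ∀ (t : ℝ) (x : R3),
      deriv (fun s => p (s, x)) t + dot3 (V (t, x)) (grad3 (fun y => p (t, y)) x) = 0)
    (hadvq : ∀ (t : ℝ) (x : R3),
      deriv (fun s => q (s, x)) t + dot3 (V (t, x)) (grad3 (fun y => q (t, y)) x) = 0)
    (hadvr : ∀ (t : ℝ) (x : R3),
      deriv (fun s => r (s, x)) t + dot3 (V (t, x)) (grad3 (fun y => r (t, y)) x) = 0) :
    ∀ (t : ℝ) (x : R3),
      deriv (fun s => det3 (grad3 (fun y => p (s, y)) x) (grad3 (fun y => q (s, y)) x)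
                           (grad3 (fun y => r (s, y)) x)) t
        + div3 (fun y => det3 (grad3 (fun z => p (t, z)) y) (grad3 (fun z => q (t, z)) y)
                              (grad3 (fun z => r (t, z)) y) • V (t, y)) x = 0 := by
  intro t x
  have hpd : Differentiable ℝ p := hp.differentiable (by norm_num)
  have hqd : Differentiable ℝ q := hq.differentiable (by norm_num)
  have hrd : Differentiable ℝ r := hr.differentiable (by norm_num)
  have hVd : Differentiable ℝ V := hV.differentiable (by norm_num)
  simp only [grad3_slice hpd, grad3_slice hqd, grad3_slice hrd, div3]
  obtain ⟨L, hL, hLv⟩ := hasFDerivAt_det3 (z := (t, x))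
    (P := fun z i => fderiv ℝ p z (spatialDir i)) (Q := fun z i => fderiv ℝ q z (spatialDir i))
    (R := fun z i => fderiv ℝ r z (spatialDir i))
    (fun i => hasFDerivAt_fderiv_apply hp _ (spatialDir i))
    (fun i => hasFDerivAt_fderiv_apply hq _ (spatialDir i))
    (fun i => hasFDerivAt_fderiv_apply hr _ (spatialDir i))
  have hVi : ∀ i, DifferentiableAt ℝ (fun z => V z i) (t, x) :=
    differentiableAt_pi.1 (hVd (t, x))
  have hdiv : ∀ i, pd3 i (fun y => (det3 (fun i => fderiv ℝ p (t, y) (spatialDir i))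
      (fun i => fderiv ℝ q (t, y) (spatialDir i)) (fun i => fderiv ℝ r (t, y) (spatialDir i))
        • V (t, y)) i) x = _ := fun i =>
    (pd3_slice (hL.mul (hVi i).hasFDerivAt).differentiableAt i).trans
      (by rw [(hL.mul (hVi i).hasFDerivAt).fderiv])
  have htime := deriv_slice hL.differentiableAt
  rw [hL.fderiv] at htime
  rw [htime]
  simp only [hdiv]
  simp only [Fin.sum_univ_three, add_apply, smul_apply, smul_eq_mul, hLv, det3_eq,
    ContinuousLinearMap.flip_apply]
  have ap := fun j => advected_fderiv hVd hp hadvp (t, x) (spatialDir j)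
  have aq := fun j => advected_fderiv hVd hq hadvq (t, x) (spatialDir j)
  have ar := fun j => advected_fderiv hVd hr hadvr (t, x) (spatialDir j)
  simp only [Fin.sum_univ_three] at ap aq ar
  obtain ⟨P, hP⟩ : ∃ P : R3, ∀ i, fderiv ℝ p (t, x) (spatialDir i) = P i := ⟨_, fun _ => rfl⟩
  obtain ⟨Q, hQ⟩ : ∃ Q : R3, ∀ i, fderiv ℝ q (t, x) (spatialDir i) = Q i := ⟨_, fun _ => rfl⟩
  obtain ⟨R, hR⟩ : ∃ R : R3, ∀ i, fderiv ℝ r (t, x) (spatialDir i) = R i := ⟨_, fun _ => rfl⟩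
  simp only [hP, hQ, hR] at ap aq ar ⊢
  linear_combination
    (Q 1 * R 2 - Q 2 * R 1) * ap 0 + (Q 2 * R 0 - Q 0 * R 2) * ap 1
    + (Q 0 * R 1 - Q 1 * R 0) * ap 2
    + (R 1 * P 2 - R 2 * P 1) * aq 0 + (R 2 * P 0 - R 0 * P 2) * aq 1
    + (R 0 * P 1 - R 1 * P 0) * aq 2
    + (P 1 * Q 2 - P 2 * Q 1) * ar 0 + (P 2 * Q 0 - P 0 * Q 2) * ar 1
    + (P 0 * Q 1 - P 1 * Q 0) * ar 2
end
end

section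
/- (Generalized enstrophy conservation for epi-2D flow.) Let V : ℝ × ℝ³ → ℝ³ be continuously differentiable, and let φ : ℝ × ℝ³ → ℝ³ be twice continuously differentiable with φ(0,x) = x, ∂ₜφ(t,x) = V(t, φ(t,x)) for all (t,x), and with φ(t,·) : ℝ³ → ℝ³ injective for each t. Let p, q, r : ℝ × ℝ³ → ℝ be twice continuously differentiable and each advected by V (∂ₜf + ⟨V, ∇f⟩ = 0), and let ρ : ℝ × ℝ³ → ℝ be continuously differentiable, nowhere zero, satisfying the continuity equation ∂ₜρ + div(ρV) = 0. Define ϑ(t,x) := det[∇p(t,x) | ∇q(t,x) | ∇r(t,x)] / ρ(t,x). Let g : ℝ → ℝ be continuous and let Ω ⊆ ℝ³ be a measurable set such that x ↦ g(ϑ(0,x))·ρ(0,x) is integrable on Ω. Then the generalized enstrophy Q(t) := ∫_{φ(t,·)(Ω)} g(ϑ(t,y))·ρ(t,y) dy is defined and equals ∫_Ω g(ϑ(0,x))·ρ(0,x) dx for every t; in particular Q is constant in t. -/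
open MeasureTheory

noncomputable section

/-- The generalized potential vorticity ϑ = det[∇p | ∇q | ∇r]/ρ of epi-2D flow. -/
def gpv (p q r ρ : ℝ × R3 → ℝ) (t : ℝ) (x : R3) : ℝ :=
  det3 (grad3 (fun y => p (t, y)) x) (grad3 (fun y => q (t, y)) x)
       (grad3 (fun y => r (t, y)) x) / ρ (t, x)

/-- A linear functional on ℝ³ expanded in the standard basis. -/
lemma ContinuousLinearMap.apply_eq_sum_single (L : R3 →L[ℝ] ℝ) (v : R3) :
    L v = ∑ i, v i * L (Pi.single i 1) := by
  conv_lhs => rw [pi_eq_sum_univ' v]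
  simp only [map_sum, map_smul, smul_eq_mul]

lemma hasFDerivAt_slice {F : Type*} [NormedAddCommGroup F] [NormedSpace ℝ F]
    {f : ℝ × R3 → F} {t : ℝ} {x : R3} (hf : DifferentiableAt ℝ f (t, x)) :
    HasFDerivAt (fun y => f (t, y))
      ((fderiv ℝ f (t, x)).comp (ContinuousLinearMap.inr ℝ ℝ R3)) x :=
  hf.hasFDerivAt.comp x (hasFDerivAt_prodMk_right t x)

lemma hasDerivAt_slice {F : Type*} [NormedAddCommGroup F] [NormedSpace ℝ F]
    {f : ℝ × R3 → F} {t : ℝ} {x : R3} (hf : DifferentiableAt ℝ f (t, x)) :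
    HasDerivAt (fun s => f (s, x)) (fderiv ℝ f (t, x) (1, 0)) t :=
  hf.hasFDerivAt.comp_hasDerivAt t ((hasDerivAt_id t).prodMk (hasDerivAt_const t x))

lemma dot3_grad3 (f : R3 → ℝ) (x v : R3) : dot3 v (grad3 f x) = fderiv ℝ f x v :=
  ((fderiv ℝ f x).apply_eq_sum_single v).symm

/-- The derivative of a field along a trajectory is its material derivative. -/
lemma hasDerivAt_along_trajectory {f : ℝ × R3 → ℝ} {γ : ℝ → R3} {t : ℝ} {v : R3}
    (hf : DifferentiableAt ℝ f (t, γ t)) (hγ : HasDerivAt γ v t) :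
    HasDerivAt (fun s => f (s, γ s))
      (deriv (fun s => f (s, γ t)) t + dot3 v (grad3 (fun y => f (t, y)) (γ t))) t := by
  have h : HasDerivAt (fun s => f (s, γ s)) (fderiv ℝ f (t, γ t) (1, v)) t :=
    hf.hasFDerivAt.comp_hasDerivAt t ((hasDerivAt_id t).prodMk hγ)
  refine h.congr_deriv ?_
  rw [dot3_grad3, (hasDerivAt_slice hf).deriv, (hasFDerivAt_slice hf).fderiv,
    ContinuousLinearMap.comp_apply, ContinuousLinearMap.inr_apply, ← map_add]
  simp

lemma div3_smul {f : R3 → ℝ} {V : R3 → R3} {x : R3} (hf : DifferentiableAt ℝ f x)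
    (hV : DifferentiableAt ℝ V x) :
    div3 (fun y => f y • V y) x = dot3 (V x) (grad3 f x) + f x * div3 V x := by
  have hc (i : Fin 3) : DifferentiableAt ℝ (fun y => V y i) x := differentiableAt_pi.1 hV i
  simp only [div3, dot3, grad3, pd3, Finset.mul_sum, ← Finset.sum_add_distrib, Pi.smul_apply,
    smul_eq_mul]
  refine Finset.sum_congr rfl fun i _ => ?_
  rw [fderiv_fun_mul hf (hc i)]
  simp [add_comm]

lemma div3_eq_trace {V : R3 → R3} {x : R3} (hV : DifferentiableAt ℝ V x) :
    div3 V x = (LinearMap.toMatrix' (fderiv ℝ V x : R3 →ₗ[ℝ] R3)).trace := by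
  simp only [div3, pd3, Matrix.trace, Matrix.diag_apply, LinearMap.toMatrix'_apply]
  refine Finset.sum_congr rfl fun i _ => ?_
  rw [(hasFDerivAt_pi'.1 hV.hasFDerivAt i).fderiv]
  simp

/-- Jacobi's formula (Liouville's theorem) for solutions of `A' = B A` in dimension three. -/
lemma hasDerivAt_det_of_linear_ode {A : ℝ → Matrix (Fin 3) (Fin 3) ℝ}
    {B : Matrix (Fin 3) (Fin 3) ℝ} {t : ℝ}
    (hA : ∀ i j, HasDerivAt (fun s => A s i j) ((B * A t) i j) t) :
    HasDerivAt (fun s => (A s).det) (B.trace * (A t).det) t := by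
  simp only [Matrix.det_fin_three]
  refine HasDerivAt.congr_deriv ((((((((hA 0 0).mul (hA 1 1)).mul (hA 2 2)).sub
    (((hA 0 0).mul (hA 1 2)).mul (hA 2 1))).sub
    (((hA 0 1).mul (hA 1 0)).mul (hA 2 2))).add
    (((hA 0 1).mul (hA 1 2)).mul (hA 2 0))).add
    (((hA 0 2).mul (hA 1 0)).mul (hA 2 1))).sub
    (((hA 0 2).mul (hA 1 1)).mul (hA 2 0))) ?_
  simp only [Matrix.trace_fin_three, Matrix.mul_apply, Fin.sum_univ_three, Pi.mul_apply]
  ring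

/-- The variational equation: the spatial derivative of a flow solves the linearized equation. -/
lemma hasDerivAt_fderiv_flow {V φ : ℝ × R3 → R3} (hV : ContDiff ℝ 1 V) (hφ : ContDiff ℝ 2 φ)
    (hflow : ∀ (t : ℝ) (x : R3), deriv (fun s => φ (s, x)) t = V (t, φ (t, x)))
    (t : ℝ) (x e : R3) :
    HasDerivAt (fun s => fderiv ℝ (fun y => φ (s, y)) x e)
      (fderiv ℝ (fun y => V (t, y)) (φ (t, x)) (fderiv ℝ (fun y => φ (t, y)) x e)) t := by
  have hφd : Differentiable ℝ φ := hφ.differentiable (by norm_num)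
  have hVd : Differentiable ℝ V := hV.differentiable (by norm_num)
  have hdd : Differentiable ℝ (fderiv ℝ φ) :=
    (hφ.fderiv_right (m := 1) (by norm_num)).differentiable (by norm_num)
  have htime : (fun y => fderiv ℝ φ (t, y) (1, 0)) = fun y => V (t, φ (t, y)) := by
    funext y
    rw [← hflow, (hasDerivAt_slice (hφd (t, y))).deriv]
  have hsymm : fderiv ℝ (fderiv ℝ φ) (t, x) (1, 0) (0, e)
      = fderiv ℝ (fderiv ℝ φ) (t, x) (0, e) (1, 0) :=
    (hφ.contDiffAt.isSymmSndFDerivAt (by simp)) (1, 0) (0, e)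
  have hspace : HasFDerivAt (fun y => fderiv ℝ φ (t, y) (1, 0))
      (((ContinuousLinearMap.apply ℝ R3 ((1, 0) : ℝ × R3)).comp
        ((fderiv ℝ (fderiv ℝ φ) (t, x)).comp (ContinuousLinearMap.inr ℝ ℝ R3)))) x :=
    (ContinuousLinearMap.apply ℝ R3 ((1, 0) : ℝ × R3)).hasFDerivAt.comp x
      (hasFDerivAt_slice (hdd (t, x)))
  have hchain := (hasFDerivAt_slice (hVd (t, φ (t, x)))).comp x (hasFDerivAt_slice (hφd (t, x)))
  rw [htime] at hspace
  have heq := congrArg (fun L => L e) (hspace.unique hchain)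
  have hslice (s : ℝ) : fderiv ℝ (fun y => φ (s, y)) x e = fderiv ℝ φ (s, x) (0, e) := by
    rw [(hasFDerivAt_slice (hφd (s, x))).fderiv]
    simp
  have hderiv := (hasDerivAt_slice (hdd (t, x))).clm_apply (hasDerivAt_const t ((0, e) : ℝ × R3))
  simp only [hslice]
  refine hderiv.congr_deriv ?_
  rw [(hasFDerivAt_slice (hVd (t, φ (t, x)))).fderiv]
  simp only [map_zero, add_zero]
  rw [hsymm]
  simpa using heq

/-- Euler's expansion formula for the Jacobian determinant of a flow. -/
lemma hasDerivAt_det_fderiv_flow {V φ : ℝ × R3 → R3} (hV : ContDiff ℝ 1 V)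
    (hφ : ContDiff ℝ 2 φ)
    (hflow : ∀ (t : ℝ) (x : R3), deriv (fun s => φ (s, x)) t = V (t, φ (t, x)))
    (t : ℝ) (x : R3) :
    HasDerivAt (fun s => (fderiv ℝ (fun y => φ (s, y)) x).det)
      (div3 (fun y => V (t, y)) (φ (t, x)) * (fderiv ℝ (fun y => φ (t, y)) x).det) t := by
  have hVd : Differentiable ℝ V := hV.differentiable (by norm_num)
  rw [div3_eq_trace (hasFDerivAt_slice (hVd _)).differentiableAt]
  simp only [ContinuousLinearMap.det, ← LinearMap.det_toMatrix']
  refine hasDerivAt_det_of_linear_ode fun i j => ?_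
  rw [← LinearMap.toMatrix'_comp]
  simpa [LinearMap.toMatrix'_apply] using
    hasDerivAt_pi.1 (hasDerivAt_fderiv_flow hV hφ hflow t x (Pi.single j 1)) i

/-- Mass conservation in Lagrangian form. -/
lemma density_mul_det_fderiv_flow {V φ : ℝ × R3 → R3} {ρ : ℝ × R3 → ℝ} (hV : ContDiff ℝ 1 V)
    (hφ : ContDiff ℝ 2 φ) (hφ0 : ∀ x : R3, φ (0, x) = x)
    (hflow : ∀ (t : ℝ) (x : R3), deriv (fun s => φ (s, x)) t = V (t, φ (t, x)))
    (hρ : ContDiff ℝ 1 ρ)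
    (hcont : ∀ (t : ℝ) (x : R3),
      deriv (fun s => ρ (s, x)) t + div3 (fun y => ρ (t, y) • V (t, y)) x = 0)
    (t : ℝ) (x : R3) :
    ρ (t, φ (t, x)) * (fderiv ℝ (fun y => φ (t, y)) x).det = ρ (0, x) := by
  have hVd : Differentiable ℝ V := hV.differentiable (by norm_num)
  have hφd : Differentiable ℝ φ := hφ.differentiable (by norm_num)
  have hρd : Differentiable ℝ ρ := hρ.differentiable (by norm_num)
  have hderiv (s : ℝ) : HasDerivAt
      (fun s => ρ (s, φ (s, x)) * (fderiv ℝ (fun y => φ (s, y)) x).det) 0 s := by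
    have hγ : HasDerivAt (fun s => φ (s, x)) (V (s, φ (s, x))) s := by
      rw [← hflow]
      exact (hasDerivAt_slice (hφd (s, x))).differentiableAt.hasDerivAt
    refine ((hasDerivAt_along_trajectory (hρd _) hγ).mul
      (hasDerivAt_det_fderiv_flow hV hφ hflow s x)).congr_deriv ?_
    have hc := hcont s (φ (s, x))
    rw [div3_smul (hasFDerivAt_slice (hρd _)).differentiableAt
      (hasFDerivAt_slice (hVd _)).differentiableAt] at hc
    linear_combination (fderiv ℝ (fun y => φ (s, y)) x).det * hc
  have h := is_const_of_deriv_eq_zero (fun s => (hderiv s).differentiableAt)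
    (fun s => (hderiv s).deriv) t 0
  simpa [hφ0, ContinuousLinearMap.det] using h

/-- Advected scalars are constant along trajectories. -/
lemma advected_along_flow {V φ : ℝ × R3 → R3} {f : ℝ × R3 → ℝ}
    (hφ : Differentiable ℝ φ) (hφ0 : ∀ x : R3, φ (0, x) = x)
    (hflow : ∀ (t : ℝ) (x : R3), deriv (fun s => φ (s, x)) t = V (t, φ (t, x)))
    (hf : Differentiable ℝ f)
    (hadv : ∀ (t : ℝ) (x : R3),
      deriv (fun s => f (s, x)) t + dot3 (V (t, x)) (grad3 (fun y => f (t, y)) x) = 0)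
    (t : ℝ) (x : R3) : f (t, φ (t, x)) = f (0, x) := by
  have hderiv (s : ℝ) : HasDerivAt (fun s => f (s, φ (s, x))) 0 s := by
    have hγ : HasDerivAt (fun s => φ (s, x)) (V (s, φ (s, x))) s := by
      rw [← hflow]
      exact (hasDerivAt_slice (hφ (s, x))).differentiableAt.hasDerivAt
    rw [← hadv s (φ (s, x))]
    exact hasDerivAt_along_trajectory (hf _) hγ
  have h := is_const_of_deriv_eq_zero (fun s => (hderiv s).differentiableAt)
    (fun s => (hderiv s).deriv) t 0
  simpa [hφ0] using h

/-- The gradient of a composition is the transposed Jacobian applied to the gradient. -/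
lemma grad3_comp {f : R3 → ℝ} {ψ : R3 → R3} {x : R3} (hf : DifferentiableAt ℝ f (ψ x))
    (hψ : DifferentiableAt ℝ ψ x) :
    grad3 (fun y => f (ψ y)) x =
      Matrix.vecMul (grad3 f (ψ x)) (LinearMap.toMatrix' (fderiv ℝ ψ x : R3 →ₗ[ℝ] R3)) := by
  funext j
  simp only [grad3, pd3]
  rw [fderiv_fun_comp x hf hψ,
    ContinuousLinearMap.comp_apply, ContinuousLinearMap.apply_eq_sum_single]
  simp [Matrix.vecMul, dotProduct, LinearMap.toMatrix'_apply, grad3, pd3, mul_comm]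

lemma det3_vecMul (u v w : R3) (M : Matrix (Fin 3) (Fin 3) ℝ) :
    det3 (Matrix.vecMul u M) (Matrix.vecMul v M) (Matrix.vecMul w M) = det3 u v w * M.det := by
  simp only [det3, Matrix.det_transpose, ← Matrix.det_mul]
  congr 1
  ext i j
  fin_cases i <;> simp [Matrix.mul_apply, Matrix.vecMul, dotProduct]

/-- Paper's Theorem 1: the generalized enstrophy
Q(t) = ∫_{φ(t,·)(Ω)} g(ϑ) ρ over a co-moving volume is defined and constant in time. -/
theorem generalized_enstrophy_conservation
    (V : ℝ × R3 → R3) (φ : ℝ × R3 → R3) (p q r ρ : ℝ × R3 → ℝ)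
    (hV : ContDiff ℝ 1 V) (hφ : ContDiff ℝ 2 φ)
    (hφ0 : ∀ x : R3, φ (0, x) = x)
    (hflow : ∀ (t : ℝ) (x : R3), deriv (fun s => φ (s, x)) t = V (t, φ (t, x)))
    (hinj : ∀ t : ℝ, Function.Injective fun x => φ (t, x))
    (hp : ContDiff ℝ 2 p) (hq : ContDiff ℝ 2 q) (hr : ContDiff ℝ 2 r)
    (hadvp : ∀ (t : ℝ) (x : R3),
      deriv (fun s => p (s, x)) t + dot3 (V (t, x)) (grad3 (fun y => p (t, y)) x) = 0)
    (hadvq : ∀ (t : ℝ) (x : R3),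
      deriv (fun s => q (s, x)) t + dot3 (V (t, x)) (grad3 (fun y => q (t, y)) x) = 0)
    (hadvr : ∀ (t : ℝ) (x : R3),
      deriv (fun s => r (s, x)) t + dot3 (V (t, x)) (grad3 (fun y => r (t, y)) x) = 0)
    (hρ : ContDiff ℝ 1 ρ) (hρne : ∀ (t : ℝ) (x : R3), ρ (t, x) ≠ 0)
    (hcont : ∀ (t : ℝ) (x : R3),
      deriv (fun s => ρ (s, x)) t + div3 (fun y => ρ (t, y) • V (t, y)) x = 0)
    (g : ℝ → ℝ) (hg : Continuous g)
    (Ω : Set R3) (hΩ : MeasurableSet Ω)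
    (hint : IntegrableOn (fun x => g (gpv p q r ρ 0 x) * ρ (0, x)) Ω volume) :
    ∀ t : ℝ,
      IntegrableOn (fun y => g (gpv p q r ρ t y) * ρ (t, y)) ((fun x => φ (t, x)) '' Ω) volume
      ∧ ∫ y in (fun x => φ (t, x)) '' Ω, g (gpv p q r ρ t y) * ρ (t, y)
          = ∫ x in Ω, g (gpv p q r ρ 0 x) * ρ (0, x) := by
  intro t
  have hφd : Differentiable ℝ φ := hφ.differentiable (by norm_num)
  have hpd : Differentiable ℝ p := hp.differentiable (by norm_num)
  have hqd : Differentiable ℝ q := hq.differentiable (by norm_num)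
  have hrd : Differentiable ℝ r := hr.differentiable (by norm_num)
  have hmass := density_mul_det_fderiv_flow hV hφ hφ0 hflow hρ hcont
  have hdet_ne (s : ℝ) (x : R3) : (fderiv ℝ (fun y => φ (s, y)) x).det ≠ 0 := fun h =>
    hρne 0 x (by rw [← hmass s x, h, mul_zero])
  have hdet_pos (x : R3) : 0 < (fderiv ℝ (fun y => φ (t, y)) x).det := by
    by_contra! hle
    have hcts : Continuous fun s => (fderiv ℝ (fun y => φ (s, y)) x).det :=
      continuous_iff_continuousAt.2 fun s =>
        (hasDerivAt_det_fderiv_flow hV hφ hflow s x).continuousAt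
    obtain ⟨s, hs⟩ := mem_range_of_exists_le_of_exists_ge (c := (0 : ℝ)) hcts ⟨t, hle⟩
      ⟨0, by simp [hφ0, ContinuousLinearMap.det]⟩
    exact hdet_ne s x hs
  have hgrad {f : ℝ × R3 → ℝ} (hf : Differentiable ℝ f)
      (hadv : ∀ (t : ℝ) (x : R3),
        deriv (fun s => f (s, x)) t + dot3 (V (t, x)) (grad3 (fun y => f (t, y)) x) = 0)
      (x : R3) : grad3 (fun y => f (0, y)) x = Matrix.vecMul (grad3 (fun y => f (t, y)) (φ (t, x)))
        (LinearMap.toMatrix' (fderiv ℝ (fun y => φ (t, y)) x : R3 →ₗ[ℝ] R3)) := by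
    rw [← grad3_comp (f := fun y => f (t, y)) (ψ := fun y => φ (t, y))
      (hasFDerivAt_slice (hf _)).differentiableAt (hasFDerivAt_slice (hφd _)).differentiableAt]
    simp only [advected_along_flow hφd hφ0 hflow hf hadv]
  have hgpv (x : R3) : gpv p q r ρ t (φ (t, x)) = gpv p q r ρ 0 x := by
    simp only [gpv]
    rw [hgrad hpd hadvp, hgrad hqd hadvq, hgrad hrd hadvr, det3_vecMul, LinearMap.det_toMatrix',
      ← hmass t x]
    exact (mul_div_mul_right _ _ (hdet_ne t x)).symm
  have hpullback (x : R3) : |(fderiv ℝ (fun y => φ (t, y)) x).det| •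
      (g (gpv p q r ρ t (φ (t, x))) * ρ (t, φ (t, x))) = g (gpv p q r ρ 0 x) * ρ (0, x) := by
    rw [abs_of_pos (hdet_pos x), hgpv, ← hmass t x, smul_eq_mul]
    ring
  have hfderiv : ∀ x ∈ Ω, HasFDerivWithinAt (fun x => φ (t, x))
      (fderiv ℝ (fun y => φ (t, y)) x) Ω x := fun x _ =>
    (hasFDerivAt_slice (hφd (t, x))).differentiableAt.hasFDerivAt.hasFDerivWithinAt
  constructor
  · rw [integrableOn_image_iff_integrableOn_abs_det_fderiv_smul volume hΩ hfderiv
      (hinj t).injOn]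
    simpa only [hpullback] using hint
  · rw [integral_image_eq_integral_abs_det_fderiv_smul volume hΩ hfderiv (hinj t).injOn]
    simp only [hpullback]
end
end

section
/- (Frobenius integrability.) Let U ⊆ ℝ³ be open, let V : U → ℝ³ be smooth (C^∞) with zero helicity density on U, i.e. ⟨V(x), curl V(x)⟩ = 0 for all x ∈ U, and let x₀ ∈ U with V(x₀) ≠ 0. Then there exist an open neighborhood W ⊆ U of x₀ and smooth functions α, β : W → ℝ such that V(x) = α(x)·∇β(x) for all x ∈ W. -/
open MeasureTheory

noncomputable section

section

open Set Filter Topology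
open scoped ContDiff

variable {K E F : Type} [TopologicalSpace K] [CompactSpace K]
  [NormedAddCommGroup E] [NormedSpace ℝ E] [NormedAddCommGroup F] [NormedSpace ℝ F]

/-- Pointwise application of a continuous family of continuous linear maps. -/
def pointwiseApply (K E F : Type) [TopologicalSpace K] [CompactSpace K]
    [NormedAddCommGroup E] [NormedSpace ℝ E] [NormedAddCommGroup F] [NormedSpace ℝ F] :
    C(K, E →L[ℝ] F) →L[ℝ] C(K, E) →L[ℝ] C(K, F) :=
  LinearMap.mkContinuous₂
    (LinearMap.mk₂ ℝ (fun (A : C(K, E →L[ℝ] F)) (v : C(K, E)) =>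
        (⟨fun t => A t (v t), by fun_prop⟩ : C(K, F)))
      (fun _ _ _ => by ext; simp) (fun _ _ _ => by ext; simp)
      (fun _ _ _ => by ext; simp) (fun _ _ _ => by ext; simp)) 1
    fun A v => (ContinuousMap.norm_le _ (by positivity)).2 fun t => by
      simpa using (A t).le_of_opNorm_le_of_le (A.norm_coe_le_norm t) (v.norm_coe_le_norm t)

@[simp]
theorem pointwiseApply_apply (A : C(K, E →L[ℝ] F)) (v : C(K, E)) (t : K) :
    pointwiseApply K E F A v t = A t (v t) := rfl

theorem hasFDerivAt_continuousMap_comp {f : E → F} (hf : ContDiff ℝ 1 f) (γ : C(K, E)) :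
    HasFDerivAt (fun γ : C(K, E) => (⟨f, hf.continuous⟩ : C(E, F)).comp γ)
      (pointwiseApply K E F
        ((⟨fderiv ℝ f, hf.continuous_fderiv one_ne_zero⟩ : C(E, E →L[ℝ] F)).comp γ)) γ := by
  set D : C(E, E →L[ℝ] F) := ⟨fderiv ℝ f, hf.continuous_fderiv one_ne_zero⟩
  rw [hasFDerivAt_iff_isLittleO_nhds_zero, Asymptotics.isLittleO_iff]
  intro c hc
  obtain ⟨δ, hδ, H⟩ := (Metric.continuousAt_iff (f := fun γ : C(K, E) => D.comp γ)
    (a := γ)).1 (D.continuous_postcomp (X := K)).continuousAt c hc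
  filter_upwards [Metric.ball_mem_nhds (0 : C(K, E)) hδ] with v hv
  refine (ContinuousMap.norm_le _ (by positivity)).2 fun t => ?_
  have key : ∀ y ∈ Metric.ball (γ t) δ, ‖fderiv ℝ f y - fderiv ℝ f (γ t)‖ ≤ c := by
    intro y hy
    have h1 : dist (γ + ContinuousMap.const K (y - γ t)) γ < δ := by
      rw [dist_eq_norm, add_sub_cancel_left]
      refine lt_of_le_of_lt ((ContinuousMap.norm_le _ (norm_nonneg (y - γ t))).2 fun _ => ?_)
        (mem_ball_iff_norm.1 hy)
      simp
    have h2 := (ContinuousMap.dist_apply_le_dist t).trans (H h1).le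
    simpa [D, dist_eq_norm] using h2
  have hvt : ‖v t‖ < δ := (v.norm_coe_le_norm t).trans_lt (by simpa using hv)
  have := (convex_ball (γ t) δ).norm_image_sub_le_of_norm_hasFDerivWithin_le'
    (f := f) (f' := fderiv ℝ f) (φ := fderiv ℝ f (γ t)) (C := c) (x := γ t) (y := γ t + v t)
    (fun x _ => (hf.differentiable one_ne_zero x).hasFDerivAt.hasFDerivWithinAt) key
    (Metric.mem_ball_self hδ) (by simpa using hvt)
  simp only [add_sub_cancel_left] at this
  calc _ ≤ c * ‖v t‖ := by simpa [D] using this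
    _ ≤ c * ‖v‖ := by gcongr; exact v.norm_coe_le_norm t

theorem contDiff_continuousMap_comp {f : E → F} (hf : ContDiff ℝ ∞ f) :
    ContDiff ℝ ∞ (fun γ : C(K, E) => (⟨f, hf.continuous⟩ : C(E, F)).comp γ) := by
  rw [contDiff_infty]
  intro n
  induction n generalizing F with
  | zero => exact contDiff_zero.2 (ContinuousMap.continuous_postcomp _)
  | succ n ih =>
    refine contDiff_succ_iff_hasFDerivAt.2 ⟨_, ?_, fun γ =>
      hasFDerivAt_continuousMap_comp (hf.of_le (by simp)) γ⟩
    exact (pointwiseApply K E F).contDiff.comp (ih (contDiff_infty_iff_fderiv.1 hf).2)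

theorem exists_implicit_contDiffAt_nhds {E₁ E₂ : Type*}
    [NormedAddCommGroup E₁] [NormedSpace ℝ E₁] [CompleteSpace E₁]
    [NormedAddCommGroup E₂] [NormedSpace ℝ E₂] [CompleteSpace E₂]
    {f : E₁ × E₂ → E₂} (hf : ContDiff ℝ ∞ f) (u : E₁ × E₂)
    (hu : (fderiv ℝ f u ∘L .inr ℝ E₁ E₂).IsInvertible) :
    ∃ ψ : E₁ → E₂, ψ u.1 = u.2 ∧
      ∀ᶠ x in 𝓝 u.1, f (x, ψ x) = f u ∧ ContDiffAt ℝ ∞ ψ x := by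
  have hn : (∞ : WithTop ℕ∞) ≠ 0 := by simp
  set ψ := hf.contDiffAt.implicitFunction hn hu
  have h0 : ψ u.1 = u.2 := hf.contDiffAt.implicitFunction_apply_self hn hu
  have hc : ContDiffAt ℝ ∞ ψ u.1 := hf.contDiffAt.contDiffAt_implicitFunction hn hu
  have hinv : ∀ᶠ v in 𝓝 u, (fderiv ℝ f v ∘L .inr ℝ E₁ E₂).IsInvertible := by
    have hcont : Continuous fun v => fderiv ℝ f v ∘L .inr ℝ E₁ E₂ :=
      (hf.continuous_fderiv hn).clm_comp continuous_const
    obtain ⟨e, he⟩ := hu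
    exact (hcont.continuousAt (x := u)).eventually (p := ContinuousLinearMap.IsInvertible)
      (by simpa only [← he] using! e.nhds)
  have hiff := hf.contDiffAt.eventually_apply_eq_iff_implicitFunction hn hu
  have ht : Tendsto (fun x => (x, ψ x)) (𝓝 u.1) (𝓝 u) := by
    have := (continuousAt_id (x := u.1)).prodMk hc.continuousAt
    simpa [ContinuousAt, h0] using this
  refine ⟨ψ, h0, ?_⟩
  filter_upwards [hf.contDiffAt.eventually_apply_implicitFunction hn hu,
    ht.eventually hinv, ht.eventually hiff.eventually_nhds] with x hx hix hex
  refine ⟨hx, ?_⟩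
  have hc' := hf.contDiffAt.contDiffAt_implicitFunction hn hix
  refine hc'.congr_of_eventuallyEq ?_
  have h1 := hf.contDiffAt.eventually_apply_implicitFunction hn hix
  have h2 : Tendsto (fun y => (y, hf.contDiffAt.implicitFunction hn hix y)) (𝓝 x)
      (𝓝 (x, ψ x)) := by
    have := (continuousAt_id (x := x)).prodMk hc'.continuousAt
    simpa [ContinuousAt, hf.contDiffAt.implicitFunction_apply_self hn hix] using this
  filter_upwards [h1, h2.eventually hex] with y hy1 hy2
  exact hy2.1 (hy1.trans hx)

/-- The value of `θ ∧ dθ` on three vectors, for a 1-form `θ`. -/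
def extDerivCyclic {E : Type*} [NormedAddCommGroup E] [NormedSpace ℝ E]
    (θ : E → E →L[ℝ] ℝ) (x a b c : E) : ℝ :=
  θ x a * (fderiv ℝ θ x b c - fderiv ℝ θ x c b) +
    θ x b * (fderiv ℝ θ x c a - fderiv ℝ θ x a c) +
    θ x c * (fderiv ℝ θ x a b - fderiv ℝ θ x b a)

theorem transport_eq_zero {E : Type*} [NormedAddCommGroup E] [NormedSpace ℝ E]
    {θ : E → E →L[ℝ] ℝ} (hθ : ContDiff ℝ 1 θ) {e x h u : E} {z n : ℝ → ℝ}
    (hz : ∀ t ∈ Icc (0 : ℝ) 1, HasDerivAt z (θ (x - t • h + z t • e) h) t)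
    (hn : ∀ t ∈ Icc (0 : ℝ) 1, HasDerivAt n
      (fderiv ℝ θ (x - t • h + z t • e) ((1 - t) • u + n t • e) h
        + θ (x - t • h + z t • e) u) t)
    (hz0 : z 0 = 0) (hn0 : n 0 = 0) (hu : θ x u = 0)
    (he : ∀ t ∈ Icc (0 : ℝ) 1, ∀ᶠ y in 𝓝 (x - t • h + z t • e), θ y e = 1)
    (hint : ∀ t ∈ Icc (0 : ℝ) 1, ∀ a b c : E,
      extDerivCyclic θ (x - t • h + z t • e) a b c = 0) :
    n 1 = 0 := by
  set γ : ℝ → E := fun t => x - t • h + z t • e with hγ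
  set ξ : ℝ → E := fun t => (1 - t) • u + n t • e with hξ
  set γ' : ℝ → E := fun t => -h + θ (γ t) h • e with hγ'
  have he1 : ∀ t ∈ Icc (0 : ℝ) 1, θ (γ t) e = 1 := fun t ht => (he t ht).self_of_nhds
  have hd : ∀ y, HasFDerivAt θ (fderiv ℝ θ y) y := fun y =>
    (hθ.differentiable one_ne_zero y).hasFDerivAt
  have hDe : ∀ t ∈ Icc (0 : ℝ) 1, ∀ a, fderiv ℝ θ (γ t) a e = 0 := by
    intro t ht a
    have h1 : HasFDerivAt (fun y => θ y e) (0 : E →L[ℝ] ℝ) (γ t) :=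
      (hasFDerivAt_const (1 : ℝ) _).congr_of_eventuallyEq (he t ht)
    have h2 := ((hd (γ t)).clm_apply (hasFDerivAt_const e (γ t))).unique h1
    simpa using congrArg (· a) h2
  have hγd : ∀ t ∈ Icc (0 : ℝ) 1, HasDerivAt γ (γ' t) t := by
    intro t ht
    have := (((hasDerivAt_id t).smul_const h).const_sub x).add ((hz t ht).smul_const e)
    simpa [hγ'] using! this
  have hγc : ContinuousOn γ (Icc 0 1) := fun t ht => (hγd t ht).continuousAt.continuousWithinAt
  set w : ℝ → ℝ := fun t => θ (γ t) (ξ t) with hw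
  set w' : ℝ → ℝ := fun t => - (fderiv ℝ θ (γ t) e (γ' t)) * w t with hw'
  have hwd : ∀ t ∈ Icc (0 : ℝ) 1, HasDerivAt w (w' t) t := by
    intro t ht
    have h1 : HasDerivAt ξ (-u + (fderiv ℝ θ (γ t) (ξ t) h + θ (γ t) u) • e) t := by
      have := (((hasDerivAt_id t).const_sub 1).smul_const u).add ((hn t ht).smul_const e)
      simpa [hξ] using! this
    have h2 := ((hd (γ t)).comp_hasDerivAt t (hγd t ht)).clm_apply h1
    refine h2.congr_deriv ?_
    have h3 : extDerivCyclic θ (γ t) e (γ' t) (ξ t) = 0 := hint t ht _ _ _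
    have h4 : θ (γ t) (γ' t) = 0 := by simp [hγ', he1 t ht]
    have h5 : fderiv ℝ θ (γ t) (ξ t) (γ' t) = - fderiv ℝ θ (γ t) (ξ t) h := by
      simp [hγ', hDe t ht]
    simp only [extDerivCyclic, h4, he1 t ht, h5, hDe t ht] at h3
    simp only [hw', hw, map_add, map_neg, map_smul, smul_eq_mul, he1 t ht, Function.comp]
    linear_combination h3
  have hcont : ContinuousOn (fun t => fderiv ℝ θ (γ t) e (γ' t)) (Icc 0 1) := by
    have h1 : ContinuousOn (fun t => fderiv ℝ θ (γ t)) (Icc 0 1) :=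
      (hθ.continuous_fderiv one_ne_zero).comp_continuousOn hγc
    have h2 : ContinuousOn (fun t => θ (γ t)) (Icc 0 1) := hθ.continuous.comp_continuousOn hγc
    exact (h1.clm_apply continuousOn_const).clm_apply
      (continuousOn_const.add ((h2.clm_apply continuousOn_const).smul continuousOn_const))
  obtain ⟨C, hC⟩ := isCompact_Icc.exists_bound_of_continuousOn hcont
  have hzero := eq_zero_of_abs_deriv_le_mul_abs_self_of_eq_zero_right (f := w) (f' := w') (K := C)
    (fun t ht => (hwd t ht).continuousAt.continuousWithinAt)
    (fun t ht => (hwd t (Ico_subset_Icc_self ht)).hasDerivWithinAt)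
    (by simp [hw, hγ, hξ, hz0, hn0, hu])
    (fun t ht => by
      rw [hw', norm_mul, norm_neg]
      gcongr
      exact hC t (Ico_subset_Icc_self ht)) 1 (right_mem_Icc.2 zero_le_one)
  simpa [hw, hξ, he1 1 (right_mem_Icc.2 zero_le_one)] using hzero

/-- Antiderivative vanishing at `0`, as a continuous linear operator on `C([0, 1], ℝ)`. -/
def antideriv : C(Icc (0 : ℝ) 1, ℝ) →L[ℝ] C(Icc (0 : ℝ) 1, ℝ) :=
  LinearMap.mkContinuous
    { toFun := fun g => ⟨fun t => ∫ s in (0 : ℝ)..t, g (projIcc 0 1 zero_le_one s),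
        (intervalIntegral.continuous_primitive (fun a b =>
          (g.continuous.comp continuous_projIcc).intervalIntegrable a b) 0).comp
            continuous_subtype_val⟩
      map_add' := fun g k => by
        ext t
        exact intervalIntegral.integral_add
          ((g.continuous.comp continuous_projIcc).intervalIntegrable _ _)
          ((k.continuous.comp continuous_projIcc).intervalIntegrable _ _)
      map_smul' := fun c g => by
        ext t
        exact intervalIntegral.integral_const_mul _ _ } 1
    fun g => (ContinuousMap.norm_le _ (by positivity)).2 fun t => by
      refine (intervalIntegral.norm_integral_le_of_norm_le_const
        (fun s _ => g.norm_coe_le_norm (projIcc 0 1 zero_le_one s))).trans ?_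
      rw [sub_zero, abs_of_nonneg t.2.1, mul_comm]
      exact mul_le_mul_of_nonneg_right t.2.2 (norm_nonneg g)

theorem antideriv_apply (g : C(Icc (0 : ℝ) 1, ℝ)) (t : Icc (0 : ℝ) 1) :
    antideriv g t = ∫ s in (0 : ℝ)..t, g (projIcc 0 1 zero_le_one s) := rfl

/-- The linear part of the family of lifted paths. -/
def pathLin {E : Type*} [NormedAddCommGroup E] [NormedSpace ℝ E] (e : E) :
    E × C(Icc (0 : ℝ) 1, ℝ) →L[ℝ] C(Icc (0 : ℝ) 1, E × E) :=
  LinearMap.mkContinuous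
    { toFun := fun p => ⟨fun t => ((1 - (t : ℝ)) • p.1 + p.2 t • e, p.1), by fun_prop⟩
      map_add' := fun p q => by
        ext t
        · simp; module
        · simp
      map_smul' := fun c p => by
        ext t
        · simp; module
        · simp } (1 + ‖e‖)
    fun p => (ContinuousMap.norm_le _ (by positivity)).2 fun t => by
      have h1 : ‖p.1‖ ≤ ‖p‖ := norm_fst_le p
      have h2 : ‖p.2 t‖ ≤ ‖p‖ := (p.2.norm_coe_le_norm t).trans (norm_snd_le p)
      have h3 : ‖1 - (t : ℝ)‖ ≤ 1 := by
        rw [Real.norm_eq_abs, abs_le]; constructor <;> linarith [t.2.1, t.2.2]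
      refine max_le ?_ ?_
      · calc ‖(1 - (t : ℝ)) • p.1 + p.2 t • e‖ ≤ ‖1 - (t : ℝ)‖ * ‖p.1‖ + ‖p.2 t‖ * ‖e‖ := by
              refine (norm_add_le _ _).trans ?_
              rw [norm_smul, norm_smul]
          _ ≤ 1 * ‖p‖ + ‖p‖ * ‖e‖ := by gcongr
          _ = (1 + ‖e‖) * ‖p‖ := by ring
      · show ‖p.1‖ ≤ _
        nlinarith [norm_nonneg e, norm_nonneg p]

theorem pathLin_apply {E : Type*} [NormedAddCommGroup E] [NormedSpace ℝ E] (e : E)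
    (p : E × C(Icc (0 : ℝ) 1, ℝ)) (t : Icc (0 : ℝ) 1) :
    pathLin e p t = ((1 - (t : ℝ)) • p.1 + p.2 t • e, p.1) := rfl

theorem hasDerivAt_integral_projIcc (g : C(Icc (0 : ℝ) 1, ℝ)) (t : ℝ) :
    HasDerivAt (fun t => ∫ s in (0 : ℝ)..t, g (projIcc 0 1 zero_le_one s))
      (g (projIcc 0 1 zero_le_one t)) t :=
  (g.continuous.comp continuous_projIcc).integral_hasStrictDerivAt 0 t |>.hasDerivAt

theorem exists_firstIntegral {E : Type} [NormedAddCommGroup E] [NormedSpace ℝ E]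
    [CompleteSpace E] {θ : E → E →L[ℝ] ℝ} (hθ : ContDiff ℝ ∞ θ) {x₀ e : E}
    (he : ∀ᶠ y in 𝓝 x₀, θ y e = 1)
    (hint : ∀ᶠ y in 𝓝 x₀, ∀ a b c : E, extDerivCyclic θ y a b c = 0) :
    ∃ β : E → ℝ, fderiv ℝ β x₀ e = 1 ∧
      ∀ᶠ x in 𝓝 x₀, ContDiffAt ℝ ∞ β x ∧ ∀ u, θ x u = 0 → fderiv ℝ β x u = 0 := by
  let F : E × E → ℝ := fun p => θ p.1 p.2
  have hF : ContDiff ℝ ∞ F := (hθ.comp contDiff_fst).clm_apply contDiff_snd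
  have hFd : ∀ p q : E × E, fderiv ℝ F p q = fderiv ℝ θ p.1 q.1 p.2 + θ p.1 q.2 := by
    intro p q
    have h1 : HasFDerivAt (fun p : E × E => θ p.1) _ p :=
      ((hθ.differentiable (by simp) p.1).hasFDerivAt).comp p hasFDerivAt_fst
    have h2 := h1.clm_apply (hasFDerivAt_snd (p := p))
    rw [show fderiv ℝ F p = _ from h2.fderiv]
    simp [add_comm]
  let K : C(Icc (0 : ℝ) 1, E × E) := ⟨fun t => ((t : ℝ) • x₀, -x₀), by fun_prop⟩
  let A : E × C(Icc (0 : ℝ) 1, ℝ) → C(Icc (0 : ℝ) 1, E × E) := fun p => pathLin e p + K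
  have hA : ∀ p, HasFDerivAt A (pathLin e) p := fun p => (pathLin e).hasFDerivAt.add_const K
  have hAt : ∀ p t, A p t = (p.1 - (t : ℝ) • (p.1 - x₀) + p.2 t • e, p.1 - x₀) := by
    intro p t
    simp only [A, K, ContinuousMap.add_apply, pathLin_apply, ContinuousMap.coe_mk, Prod.mk_add_mk]
    ext1
    · dsimp only
      module
    · simp [sub_eq_add_neg]
  let N : C(Icc (0 : ℝ) 1, E × E) → C(Icc (0 : ℝ) 1, ℝ) := fun γ =>
    (⟨F, hF.continuous⟩ : C(E × E, ℝ)).comp γ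
  let DF : C(E × E, E × E →L[ℝ] ℝ) := ⟨fderiv ℝ F, hF.continuous_fderiv (by simp)⟩
  have hN : ∀ γ, HasFDerivAt N (pointwiseApply (Icc (0 : ℝ) 1) (E × E) ℝ (DF.comp γ)) γ := fun γ =>
    hasFDerivAt_continuousMap_comp (hF.of_le (by simp)) γ
  let Φ : E × C(Icc (0 : ℝ) 1, ℝ) → C(Icc (0 : ℝ) 1, ℝ) := fun p => p.2 - antideriv (N (A p))
  have hΦ : ContDiff ℝ ∞ Φ := contDiff_snd.sub (antideriv.contDiff.comp
    ((contDiff_continuousMap_comp hF).comp ((pathLin e).contDiff.add contDiff_const)))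
  have hΦd : ∀ p, HasFDerivAt Φ (.snd ℝ E C(Icc (0 : ℝ) 1, ℝ) - antideriv ∘L
      (pointwiseApply (Icc (0 : ℝ) 1) (E × E) ℝ (DF.comp (A p)) ∘L pathLin e)) p := fun p =>
    hasFDerivAt_snd.sub (antideriv.hasFDerivAt.comp p ((hN (A p)).comp p (hA p)))
  have hA0 : ∀ t, A (x₀, 0) t = (x₀, 0) := fun t => by simp [hAt]
  have hN0 : N (A (x₀, 0)) = 0 := by
    ext t
    simp [N, F, hA0]
  have hΦ0 : Φ (x₀, 0) = 0 := by simp [Φ, hN0]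
  have hinv : fderiv ℝ Φ (x₀, 0) ∘L .inr ℝ E C(Icc (0 : ℝ) 1, ℝ) = .id ℝ _ := by
    rw [(hΦd _).fderiv]
    ext1 η
    have : pointwiseApply (Icc (0 : ℝ) 1) (E × E) ℝ (DF.comp (A (x₀, 0)))
        (pathLin e (0, η)) = 0 := by
      ext t
      simp [DF, hFd, hA0, pathLin_apply]
    simp [this]
  obtain ⟨ψ, hψ0, hψ⟩ := exists_implicit_contDiffAt_nhds hΦ (x₀, 0)
    (by rw [hinv]; exact ⟨.refl ℝ _, rfl⟩)
  simp only [hΦ0] at hψ hψ0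
  have hψd : ∀ᶠ x in 𝓝 x₀, ∀ u, fderiv ℝ ψ x u = antideriv
      (pointwiseApply (Icc (0 : ℝ) 1) (E × E) ℝ (DF.comp (A (x, ψ x)))
        (pathLin e (u, fderiv ℝ ψ x u))) := by
    filter_upwards [hψ.eventually_nhds] with x hx u
    have h1 := (hx.self_of_nhds.2.differentiableAt (by simp)).hasFDerivAt
    have h2 := (hΦd (x, ψ x)).comp x ((hasFDerivAt_id x).prodMk h1)
    have h3 : HasFDerivAt (fun y => Φ (y, ψ y)) (0 : E →L[ℝ] C(Icc (0 : ℝ) 1, ℝ)) x :=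
      (hasFDerivAt_const (0 : C(Icc (0 : ℝ) 1, ℝ)) x).congr_of_eventuallyEq
        (hx.mono fun y hy => hy.1)
    have h4 := congrArg (· u) (h2.unique h3)
    exact sub_eq_zero.1 (by simpa using h4)
  let ev : C(Icc (0 : ℝ) 1, ℝ) →L[ℝ] ℝ := ContinuousMap.evalCLM ℝ ⟨1, right_mem_Icc.2 zero_le_one⟩
  have hβd : ∀ᶠ x in 𝓝 x₀, ∀ u, fderiv ℝ (fun y => ev (ψ y)) x u = ev (fderiv ℝ ψ x u) := by
    filter_upwards [hψ] with x hx u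
    have h := ev.hasFDerivAt.comp x (hx.2.differentiableAt (by simp)).hasFDerivAt
    exact congrArg (· u) h.fderiv
  refine ⟨fun x => ev (ψ x), ?_, ?_⟩
  · rw [hβd.self_of_nhds, hψd.self_of_nhds, hψ0]
    have : pointwiseApply (Icc (0 : ℝ) 1) (E × E) ℝ (DF.comp (A (x₀, 0)))
        (pathLin e (e, fderiv ℝ ψ x₀ e)) = 1 := by
      ext t
      simp [DF, hFd, hA0, pathLin_apply, he.self_of_nhds]
    rw [this]
    simp [ev, antideriv_apply]
  · obtain ⟨O, hO, hOo, hxO⟩ := mem_nhds_iff.1 (he.eventually_nhds.and hint)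
    have hclose : ∀ᶠ x in 𝓝 x₀, ∀ t, (A (x, ψ x) t).1 ∈ O := by
      obtain ⟨r, hr, hrO⟩ := Metric.isOpen_iff.1 hOo x₀ hxO
      have hc : ContinuousAt (fun x => A (x, ψ x)) x₀ :=
        ((pathLin e).continuous.add continuous_const).continuousAt.comp
          (continuousAt_id.prodMk hψ.self_of_nhds.2.continuousAt)
      filter_upwards [Metric.tendsto_nhds.1 hc r hr] with x hx t
      refine hrO ?_
      have h1 := (ContinuousMap.dist_apply_le_dist t).trans_lt hx
      rw [hψ0, hA0] at h1
      exact (le_max_left _ _).trans_lt h1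
    filter_upwards [hψ, hψd, hβd, hclose] with x hx hd hβ hcl
    refine ⟨ev.contDiff.contDiffAt.comp x hx.2, fun u hu => ?_⟩
    rw [hβ]
    set η := fderiv ℝ ψ x u
    have hfix : ψ x = antideriv (N (A (x, ψ x))) := sub_eq_zero.1 hx.1
    let z : ℝ → ℝ := fun t => ∫ s in (0 : ℝ)..t, N (A (x, ψ x)) (projIcc 0 1 zero_le_one s)
    let n : ℝ → ℝ := fun t => ∫ s in (0 : ℝ)..t,
      pointwiseApply (Icc (0 : ℝ) 1) (E × E) ℝ (DF.comp (A (x, ψ x))) (pathLin e (u, η)) (projIcc 0 1 zero_le_one s)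
    have hz : ∀ t (ht : t ∈ Icc (0 : ℝ) 1), z t = ψ x ⟨t, ht⟩ := fun t ht =>
      (congrArg (fun f : C(Icc (0 : ℝ) 1, ℝ) => f ⟨t, ht⟩) hfix).symm
    have hn : ∀ t (ht : t ∈ Icc (0 : ℝ) 1), n t = η ⟨t, ht⟩ := fun t ht =>
      (congrArg (fun f : C(Icc (0 : ℝ) 1, ℝ) => f ⟨t, ht⟩) (hd u)).symm
    have hAz : ∀ t (ht : t ∈ Icc (0 : ℝ) 1),
        A (x, ψ x) ⟨t, ht⟩ = (x - t • (x - x₀) + z t • e, x - x₀) := fun t ht => by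
      rw [hAt, hz t ht]
    have hmem : ∀ t ∈ Icc (0 : ℝ) 1, x - t • (x - x₀) + z t • e ∈ O := fun t ht => by
      have := hcl ⟨t, ht⟩
      rwa [hAz t ht] at this
    have := transport_eq_zero (hθ.of_le (by simp)) (e := e) (x := x) (h := x - x₀) (u := u)
      (z := z) (n := n) (fun t ht => ?_) (fun t ht => ?_) (by simp [z]) (by simp [n]) hu
      (fun t ht => (hO (hmem t ht)).1) (fun t ht => (hO (hmem t ht)).2)
    · rw [hn 1 (right_mem_Icc.2 zero_le_one)] at this
      exact this
    · refine (hasDerivAt_integral_projIcc _ t).congr_deriv ?_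
      rw [projIcc_of_mem zero_le_one ht]
      show F (A (x, ψ x) ⟨t, ht⟩) = _
      rw [hAz t ht]
    · refine (hasDerivAt_integral_projIcc _ t).congr_deriv ?_
      rw [projIcc_of_mem zero_le_one ht]
      show fderiv ℝ F (A (x, ψ x) ⟨t, ht⟩) (pathLin e (u, η) ⟨t, ht⟩) = _
      rw [hAz t ht, hFd, pathLin_apply, hn t ht]

theorem extDerivCyclic_smul {E : Type*} [NormedAddCommGroup E] [NormedSpace ℝ E]
    {θ φ : E → E →L[ℝ] ℝ} {f : E → ℝ} {y : E} (h : θ =ᶠ[𝓝 y] fun x => f x • φ x)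
    (hf : DifferentiableAt ℝ f y) (hφ : DifferentiableAt ℝ φ y) (a b c : E) :
    extDerivCyclic θ y a b c = f y ^ 2 * extDerivCyclic φ y a b c := by
  simp only [extDerivCyclic, h.fderiv_eq, h.self_of_nhds, fderiv_fun_smul hf hφ,
    add_apply, smul_apply, ContinuousLinearMap.smulRight_apply, smul_eq_mul]
  ring

theorem exists_contDiff_eventuallyEq {E F : Type*} [NormedAddCommGroup E] [NormedSpace ℝ E]
    [FiniteDimensional ℝ E] [NormedAddCommGroup F] [NormedSpace ℝ F] {g : E → F} {U : Set E}
    (hU : IsOpen U) (hg : ContDiffOn ℝ ∞ g U) {x₀ : E} (hx₀ : x₀ ∈ U) :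
    ∃ g' : E → F, ContDiff ℝ ∞ g' ∧ g' =ᶠ[𝓝 x₀] g := by
  obtain ⟨r, hr, hrU⟩ := Metric.nhds_basis_closedBall.mem_iff.1 (hU.mem_nhds hx₀)
  let χ : ContDiffBump x₀ := ⟨r / 2, r, by positivity, by linarith⟩
  refine ⟨fun x => χ x • g x, contDiff_iff_contDiffAt.2 fun x => ?_, ?_⟩
  · by_cases hx : x ∈ U
    · exact χ.contDiff.contDiffAt.smul (hg.contDiffAt (hU.mem_nhds hx))
    · have hx' : x ∉ tsupport χ := fun h => hx (hrU (χ.tsupport_eq ▸ h))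
      refine (contDiffAt_const (c := (0 : F))).congr_of_eventuallyEq ?_
      filter_upwards [notMem_tsupport_iff_eventuallyEq.1 hx'] with y hy
      simp [hy]
  · filter_upwards [χ.eventuallyEq_one] with x hx
    simp [hx]

/-- A one-form `φ` with `φ ∧ dφ = 0` is, near a point where it does not vanish, a smooth multiple
of an exact form. -/
theorem exists_eventually_eq_smul_fderiv {E : Type} [NormedAddCommGroup E] [NormedSpace ℝ E]
    [FiniteDimensional ℝ E] {φ : E → E →L[ℝ] ℝ} {U : Set E} (hU : IsOpen U)
    (hφ : ContDiffOn ℝ ∞ φ U) (hint : ∀ x ∈ U, ∀ a b c : E, extDerivCyclic φ x a b c = 0)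
    {x₀ : E} (hx₀ : x₀ ∈ U) (hne : φ x₀ ≠ 0) :
    ∃ α β : E → ℝ, ∀ᶠ x in 𝓝 x₀, ContDiffAt ℝ ∞ α x ∧ ContDiffAt ℝ ∞ β x ∧
      φ x = α x • fderiv ℝ β x := by
  have : CompleteSpace E := FiniteDimensional.complete ℝ E
  obtain ⟨e, he⟩ : ∃ e, φ x₀ e ≠ 0 := by
    by_contra! h
    exact hne (ContinuousLinearMap.ext h)
  have hφat : ∀ x ∈ U, ContDiffAt ℝ ∞ φ x := fun x hx => hφ.contDiffAt (hU.mem_nhds hx)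
  have hφe : ∀ x ∈ U, ContDiffAt ℝ ∞ (fun x => φ x e) x := fun x hx =>
    (hφat x hx).clm_apply contDiffAt_const
  set U' : Set E := U ∩ {x | φ x e ≠ 0}
  have hU' : IsOpen U' := ContinuousOn.isOpen_inter_preimage
    (f := fun x => φ x e) (fun x hx => (hφe x hx).continuousAt.continuousWithinAt) hU
      isOpen_compl_singleton
  have hinvat : ∀ x ∈ U', ContDiffAt ℝ ∞ (fun x => (φ x e)⁻¹) x := fun x hx =>
    (hφe x hx.1).inv hx.2
  obtain ⟨θ, hθ, hθφ⟩ := exists_contDiff_eventuallyEq (g := fun x => (φ x e)⁻¹ • φ x) hU'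
    (fun x hx => ((hinvat x hx).smul (hφat x hx.1)).contDiffWithinAt) ⟨hx₀, he⟩
  have hU'x : ∀ᶠ x in 𝓝 x₀, x ∈ U' := hU'.mem_nhds ⟨hx₀, he⟩
  obtain ⟨β, hβ₀, hβ⟩ := exists_firstIntegral hθ (x₀ := x₀) (e := e)
    (by
      filter_upwards [hθφ, hU'x] with x hx hxU
      rw [hx]
      exact inv_mul_cancel₀ hxU.2)
    (by
      filter_upwards [hθφ.eventually_nhds, hU'x] with x hx hxU a b c
      rw [extDerivCyclic_smul hx ((hinvat x hxU).differentiableAt (by simp))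
        ((hφat x hxU.1).differentiableAt (by simp)), hint x hxU.1, mul_zero])
  have hβe : ∀ x, ContDiffAt ℝ ∞ β x → ContDiffAt ℝ ∞ (fun x => fderiv ℝ β x e) x := fun x hx =>
    (hx.fderiv_right (m := ∞) (by simp)).clm_apply contDiffAt_const
  have hβne : ∀ᶠ x in 𝓝 x₀, fderiv ℝ β x e ≠ 0 :=
    (hβe x₀ hβ.self_of_nhds.1).continuousAt.eventually_ne (by simp [hβ₀])
  refine ⟨fun x => φ x e / fderiv ℝ β x e, β, ?_⟩
  filter_upwards [hβ, hβne, hU'x, hθφ] with x hx hxe hxU hxθ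
  refine ⟨(hφe x hxU.1).div (hβe x hx.1) hxe, hx.1, ?_⟩
  ext v
  have hφx : φ x e ≠ 0 := hxU.2
  have h := hx.2 (v - ((φ x e)⁻¹ * φ x v) • e) (by
    rw [hxθ, smul_apply, map_sub, map_smul, smul_eq_mul, smul_eq_mul, mul_right_comm,
      inv_mul_cancel₀ hφx, one_mul, sub_self, mul_zero])
  simp only [map_sub, map_smul, smul_eq_mul] at h
  simp only [smul_apply, smul_eq_mul]
  rw [sub_eq_zero.1 h]
  field_simp

/-- The linear functional `⟨v, ·⟩` on `R3`, depending linearly on `v`. -/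
def dotCLM : R3 →L[ℝ] R3 →L[ℝ] ℝ :=
  ∑ i, (ContinuousLinearMap.proj i : R3 →L[ℝ] ℝ).smulRight
    (ContinuousLinearMap.proj i : R3 →L[ℝ] ℝ)

theorem dotCLM_apply (v w : R3) : dotCLM v w = ∑ i, v i * w i := by
  simp [dotCLM]

theorem extDerivCyclic_dotCLM {V : R3 → R3} {x : R3} (hV : DifferentiableAt ℝ V x) (a b c : R3) :
    extDerivCyclic (fun y => dotCLM (V y)) x a b c = det3 a b c * dot3 (V x) (curl3 V x) := by
  have h1 : fderiv ℝ (fun y => dotCLM (V y)) x = dotCLM ∘L fderiv ℝ V x :=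
    (dotCLM.hasFDerivAt.comp x hV.hasFDerivAt).fderiv
  have h2 : ∀ i j, pd3 i (fun y => V y j) x = fderiv ℝ V x (Pi.single i 1) j := fun i j => by
    rw [pd3, (hasFDerivAt_pi'.1 hV.hasFDerivAt j).fderiv]
    rfl
  have h3 : ∀ v j, fderiv ℝ V x v j = ∑ i, v i * fderiv ℝ V x (Pi.single i 1) j := fun v j => by
    conv_lhs => rw [← Finset.univ_sum_single v]
    simp only [map_sum, Finset.sum_apply]
    refine Finset.sum_congr rfl fun i _ => ?_
    rw [← smul_eq_mul, ← Pi.smul_apply, ← map_smul, ← Pi.single_smul', smul_eq_mul, mul_one]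
  generalize hM : (fun i j => fderiv ℝ V x (Pi.single i 1) j) = M
  have hMij : ∀ i j, fderiv ℝ V x (Pi.single i 1) j = M i j := fun i j => by rw [← hM]
  simp only [hMij] at h2 h3
  simp only [extDerivCyclic, h1, ContinuousLinearMap.comp_apply, dotCLM_apply, h3, dot3, curl3, h2,
    det3, Matrix.det_fin_three, Matrix.transpose_apply, Matrix.of_apply, Fin.sum_univ_three,
    Matrix.cons_val_zero, Matrix.cons_val_one, Matrix.cons_val]
  ring

theorem fderiv_eq_dotCLM_grad3 (β : R3 → ℝ) (x : R3) : fderiv ℝ β x = dotCLM (grad3 β x) := by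
  ext v
  conv_lhs => rw [← Finset.univ_sum_single v]
  rw [map_sum, dotCLM_apply]
  refine Finset.sum_congr rfl fun i _ => ?_
  rw [grad3, pd3, mul_comm, ← smul_eq_mul, ← map_smul, ← Pi.single_smul', smul_eq_mul, mul_one]

theorem dotCLM_injective : Function.Injective dotCLM := fun v w h => by
  ext i
  simpa [dotCLM_apply, Pi.single_apply] using congrArg (· (Pi.single i 1)) h

end

/-- Frobenius, paper's Lemma 2, nontrivial direction: a smooth vector field
with zero helicity density is locally integrable, V = α·∇β, near any point where V ≠ 0. -/
theorem frobenius_local_clebsch (U : Set R3) (hU : IsOpen U)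
    (V : R3 → R3) (hV : ContDiffOn ℝ (⊤ : ℕ∞) V U)
    (hhel : ∀ x ∈ U, dot3 (V x) (curl3 V x) = 0)
    (x₀ : R3) (hx₀ : x₀ ∈ U) (hVne : V x₀ ≠ 0) :
    ∃ W : Set R3, W ⊆ U ∧ IsOpen W ∧ x₀ ∈ W ∧
      ∃ α β : R3 → ℝ, ContDiffOn ℝ (⊤ : ℕ∞) α W ∧ ContDiffOn ℝ (⊤ : ℕ∞) β W ∧
        ∀ x ∈ W, V x = α x • grad3 β x := by
  obtain ⟨α, β, h⟩ := exists_eventually_eq_smul_fderiv hU (dotCLM.contDiff.comp_contDiffOn hV)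
    (fun x hx a b c => by
      have hd := (hV.contDiffAt (hU.mem_nhds hx)).differentiableAt (by simp)
      exact (extDerivCyclic_dotCLM hd a b c).trans (by rw [hhel x hx, mul_zero]))
    hx₀ (fun h => hVne (dotCLM_injective (h.trans (map_zero _).symm)))
  obtain ⟨W, hW, hWo, hxW⟩ := mem_nhds_iff.1 (h.and (hU.mem_nhds hx₀))
  refine ⟨W, fun x hx => (hW hx).2, hWo, hxW, α, β,
    fun x hx => (hW hx).1.1.contDiffWithinAt, fun x hx => (hW hx).1.2.1.contDiffWithinAt,
    fun x hx => dotCLM_injective ?_⟩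
  rw [map_smul, ← fderiv_eq_dotCLM_grad3]
  exact (hW hx).1.2.2
end
end

section
/- Let Ω ⊆ ℝ³ be open, let V : Ω → ℝ³ and φ : Ω → ℝ be smooth (C^∞), and suppose the projection of V onto solenoidal fields is helicity free on Ω: ⟨V(x) − ∇φ(x), curl V(x)⟩ = 0 for all x ∈ Ω. Let x₀ ∈ Ω with V(x₀) − ∇φ(x₀) ≠ 0. Then V is epi-2D near x₀: there exist an open neighborhood Ω' ⊆ Ω of x₀ and smooth functions p, q : Ω' → ℝ such that V(x) = ∇φ(x) + p(x)·∇q(x) for all x ∈ Ω'. -/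
open MeasureTheory

noncomputable section

open scoped ContDiff
open Set Filter Topology unitInterval

/-- Pointwise application of a continuous family of continuous linear maps. -/
def pointwiseApplyL (K : Type*) {E F : Type*} [TopologicalSpace K] [CompactSpace K]
    [NormedAddCommGroup E] [NormedSpace ℝ E] [NormedAddCommGroup F] [NormedSpace ℝ F] :
    C(K, E →L[ℝ] F) →L[ℝ] C(K, E) →L[ℝ] C(K, F) :=
  LinearMap.mkContinuous₂
    (LinearMap.mk₂ ℝ (fun (A : C(K, E →L[ℝ] F)) (α : C(K, E)) =>
        (⟨fun t => A t (α t), by fun_prop⟩ : C(K, F)))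
      (fun _ _ _ => by ext; simp) (fun _ _ _ => by ext; simp)
      (fun _ _ _ => by ext; simp) (fun _ _ _ => by ext; simp)) 1 fun A α => by
    rw [one_mul]
    refine (ContinuousMap.norm_le _ (mul_nonneg (norm_nonneg A) (norm_nonneg α))).2 fun t => ?_
    exact (A t).le_of_opNorm_le_of_le (A.norm_coe_le_norm t) (α.norm_coe_le_norm t)

@[simp]
theorem pointwiseApplyL_apply {K E F : Type*} [TopologicalSpace K] [CompactSpace K]
    [NormedAddCommGroup E] [NormedSpace ℝ E] [NormedAddCommGroup F] [NormedSpace ℝ F]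
    (A : C(K, E →L[ℝ] F)) (α : C(K, E)) (t : K) : pointwiseApplyL K A α t = A t (α t) := rfl

section Postcomp

universe u

variable {K : Type*} [TopologicalSpace K] [CompactSpace K]

theorem hasFDerivAt_postcomp {E F : Type*} [NormedAddCommGroup E] [NormedSpace ℝ E]
    [NormedAddCommGroup F] [NormedSpace ℝ F] (f : C(E, F)) (f' : C(E, E →L[ℝ] F))
    (hf : ∀ x, HasFDerivAt f (f' x) x) (α : C(K, E)) :
    HasFDerivAt (fun β : C(K, E) => f.comp β) (pointwiseApplyL K (f'.comp α)) α := by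
  rw [hasFDerivAt_iff_isLittleO, Asymptotics.isLittleO_iff]
  intro ε hε
  have hcont : Continuous (fun β : C(K, E) => f'.comp β) := ContinuousMap.continuous_postcomp f'
  obtain ⟨δ, hδ, hball⟩ := (Metric.continuous_iff (α := C(K, E)) (β := C(K, E →L[ℝ] F))).1 hcont α ε hε
  filter_upwards [Metric.ball_mem_nhds α hδ] with β hβ
  refine (ContinuousMap.norm_le _ (by positivity)).2 fun t => ?_
  have hbound : ∀ z ∈ segment ℝ (α t) (β t), ‖f' z - f' (α t)‖ ≤ ε := by
    intro z hz
    rw [segment_eq_image'] at hz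
    obtain ⟨s, ⟨hs0, hs1⟩, rfl⟩ := hz
    have hdist : dist (α + s • (β - α)) α < δ := by
      rw [dist_eq_norm, add_sub_cancel_left, norm_smul, Real.norm_of_nonneg hs0]
      rw [Metric.mem_ball, dist_eq_norm] at hβ
      nlinarith [norm_nonneg (β - α)]
    rw [← dist_eq_norm]
    exact (ContinuousMap.dist_apply_le_dist (f := f'.comp (α + s • (β - α)))
      (g := f'.comp α) t).trans (hball _ hdist).le
  have hmv := (convex_segment (α t) (β t)).norm_image_sub_le_of_norm_hasFDerivWithin_le'
    (fun z _ => (hf z).hasFDerivWithinAt) hbound (left_mem_segment ..) (right_mem_segment ..)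
  exact hmv.trans (mul_le_mul_of_nonneg_left ((β - α).norm_coe_le_norm t) hε.le)

theorem contDiff_postcomp {E F : Type u} [NormedAddCommGroup E] [NormedSpace ℝ E]
    [NormedAddCommGroup F] [NormedSpace ℝ F] (f : C(E, F)) (hf : ContDiff ℝ ∞ f) :
    ContDiff ℝ ∞ (fun β : C(K, E) => f.comp β) := by
  refine contDiff_infty.2 fun n => ?_
  induction n generalizing F with
  | zero => exact contDiff_zero.2 (ContinuousMap.continuous_postcomp f)
  | succ n ih =>
    have hf' : ContDiff ℝ ∞ (fderiv ℝ f) := hf.fderiv_right le_rfl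
    refine contDiff_succ_iff_hasFDerivAt.2
      ⟨fun α => pointwiseApplyL K ((⟨fderiv ℝ f, hf'.continuous⟩ : C(E, E →L[ℝ] F)).comp α),
        (ih ⟨fderiv ℝ f, hf'.continuous⟩ hf').continuousLinearMap_comp
          (pointwiseApplyL K), fun α => ?_⟩
    exact hasFDerivAt_postcomp f ⟨fderiv ℝ f, hf'.continuous⟩
      (fun x => (hf.differentiable (by simp) x).hasFDerivAt) α

end Postcomp

/-- The integration operator `f ↦ (t ↦ ∫ s in 0..t, f s)` on `C([0, 1], ℝ)`. -/
def primitiveL : C(I, ℝ) →L[ℝ] C(I, ℝ) :=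
  LinearMap.mkContinuous
    { toFun := fun f => ⟨fun t => ∫ s in (0 : ℝ)..t, IccExtend zero_le_one f s,
        (intervalIntegral.continuous_primitive
          (fun _ _ => (f.continuous.Icc_extend' (h := zero_le_one)).intervalIntegrable _ _) 0).comp
            continuous_subtype_val⟩
      map_add' := fun f g => by
        ext t
        exact intervalIntegral.integral_add
          ((f.continuous.Icc_extend' (h := zero_le_one)).intervalIntegrable _ _)
          ((g.continuous.Icc_extend' (h := zero_le_one)).intervalIntegrable _ _)
      map_smul' := fun c f => by
        ext t
        exact intervalIntegral.integral_const_mul c _ } 1 fun f => by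
    refine (ContinuousMap.norm_le _ (by positivity)).2 fun t => ?_
    refine (intervalIntegral.norm_integral_le_of_norm_le_const
      (C := ‖f‖) fun s _ => f.norm_coe_le_norm _).trans ?_
    rw [sub_zero, abs_of_nonneg t.2.1, one_mul]
    exact mul_le_of_le_one_right (norm_nonneg f) t.2.2

theorem primitiveL_apply (f : C(I, ℝ)) (t : I) :
    primitiveL f t = ∫ s in (0 : ℝ)..t, IccExtend zero_le_one f s := rfl

theorem hasDerivAt_integral_IccExtend (f : C(I, ℝ)) (t : ℝ) :
    HasDerivAt (fun t => ∫ s in (0 : ℝ)..t, IccExtend zero_le_one f s)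
      (IccExtend zero_le_one f t) t :=
  (f.continuous.Icc_extend' (h := zero_le_one)).integral_hasStrictDerivAt 0 t |>.hasDerivAt

/-- A parametrized fixed-point form of the implicit function theorem, smooth near the origin. -/
theorem exists_contDiffOn_implicit {X C : Type*} [NormedAddCommGroup X] [NormedSpace ℝ X]
    [CompleteSpace X] [NormedAddCommGroup C] [NormedSpace ℝ C] [CompleteSpace C]
    (F : X × C → C) (hF : ContDiff ℝ ∞ F) (hF0 : ∀ β, F (0, β) = β) :
    ∃ (B : X → C) (U : Set X), IsOpen U ∧ 0 ∈ U ∧ ContDiffOn ℝ ∞ B U ∧ B 0 = 0 ∧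
      ∀ y ∈ U, F (y, B y) = 0 := by
  set Φ : X × C → X × C := fun z => (z.1, F z)
  have hΦ : ContDiff ℝ ∞ Φ := contDiff_fst.prodMk hF
  have hD : ∀ z, HasFDerivAt Φ (fderiv ℝ Φ z) z :=
    fun z => (hΦ.differentiable (by simp) z).hasFDerivAt
  have hsnd : ∀ c, fderiv ℝ F 0 (0, c) = c := by
    intro c
    have h1 : HasFDerivAt (fun β : C => F (0, β))
        ((fderiv ℝ F 0).comp (ContinuousLinearMap.inr ℝ X C)) 0 :=
      HasFDerivAt.comp (0 : C) (hF.differentiable (by simp) (0 : X × C)).hasFDerivAt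
        (ContinuousLinearMap.inr ℝ X C).hasFDerivAt
    simp only [hF0] at h1
    simpa using DFunLike.congr_fun (h1.unique (hasFDerivAt_id 0)) c
  set A : X →L[ℝ] C := (fderiv ℝ F 0).comp (ContinuousLinearMap.inl ℝ X C) with hA
  have hDF : ∀ x c, fderiv ℝ F 0 (x, c) = A x + c := by
    intro x c
    rw [← hsnd c, hA, ContinuousLinearMap.comp_apply, ContinuousLinearMap.inl_apply, hsnd,
      ← hsnd c, ← map_add, hsnd]
    simp
  let e : (X × C) ≃L[ℝ] (X × C) := ContinuousLinearEquiv.equivOfInverse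
    ((ContinuousLinearMap.fst ℝ X C).prod
      (A.comp (ContinuousLinearMap.fst ℝ X C) + ContinuousLinearMap.snd ℝ X C))
    ((ContinuousLinearMap.fst ℝ X C).prod
      (ContinuousLinearMap.snd ℝ X C - A.comp (ContinuousLinearMap.fst ℝ X C)))
    (fun z => by simp) (fun z => by simp)
  have he : fderiv ℝ Φ 0 = e := by
    have : HasFDerivAt Φ ((ContinuousLinearMap.fst ℝ X C).prod (fderiv ℝ F 0)) 0 :=
      hasFDerivAt_fst.prodMk (hF.differentiable (by simp) (0 : X × C)).hasFDerivAt
    rw [this.fderiv]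
    ext z <;> simp [e, hDF]
  have he' : HasFDerivAt Φ (e : X × C →L[ℝ] X × C) 0 := he ▸ hD 0
  set P := hΦ.contDiffAt.toOpenPartialHomeomorph Φ he' (by simp)
  have hPcoe : (P : X × C → X × C) = Φ := rfl
  have h0s : (0 : X × C) ∈ P.source := hΦ.contDiffAt.mem_toOpenPartialHomeomorph_source he' (by simp)
  have hΦ0 : Φ 0 = 0 := by simp [Φ, show F 0 = 0 from hF0 0]
  have h0t : (0 : X × C) ∈ P.target := by
    have := P.map_source h0s
    rwa [hPcoe, hΦ0] at this
  have hsymm0 : P.symm 0 = 0 := by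
    have := P.left_inv h0s
    rwa [hPcoe, hΦ0] at this
  let R : Set (X × C) :=
    fderiv ℝ Φ ⁻¹' range ((↑) : ((X × C) ≃L[ℝ] (X × C)) → ((X × C) →L[ℝ] (X × C)))
  have hR : IsOpen R := (ContinuousLinearEquiv.isOpen (𝕜 := ℝ) (E := X × C) (F := X × C)).preimage
    (hΦ.continuous_fderiv (by simp))
  have hT : IsOpen (P.target ∩ P.symm ⁻¹' R) := P.isOpen_inter_preimage_symm hR
  refine ⟨fun y => (P.symm (y, 0)).2, (fun y : X => (y, (0 : C))) ⁻¹' (P.target ∩ P.symm ⁻¹' R),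
    hT.preimage (by fun_prop), ⟨h0t, ?_⟩, ?_, ?_, ?_⟩
  · change fderiv ℝ Φ (P.symm 0) ∈ range _
    rw [hsymm0, he]
    exact mem_range_self e
  · rintro y ⟨hyt, e', he'⟩
    have h1 : ContDiffAt ℝ ∞ P.symm (y, 0) := by
      refine P.contDiffAt_symm (f₀' := e') hyt ?_ hΦ.contDiffAt
      rw [he']
      exact hD _
    exact (contDiffAt_snd.comp y (h1.comp y (by fun_prop))).contDiffWithinAt
  · change (P.symm 0).2 = 0
    rw [hsymm0]; rfl
  · rintro y ⟨hyt, -⟩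
    have h1 : Φ (P.symm (y, 0)) = (y, 0) := P.right_inv hyt
    have h2 : (P.symm (y, 0)).1 = y := congrArg Prod.fst h1
    have h3 : F (P.symm (y, 0)) = 0 := congrArg Prod.snd h1
    have h4 : (y, (P.symm (y, 0)).2) = P.symm (y, 0) := Prod.ext h2.symm rfl
    rw [h4, h3]

section Frobenius

variable {X : Type} [NormedAddCommGroup X] [NormedSpace ℝ X]

theorem fderiv_apply_eq_zero_of_apply_eq_one {θ : X → X →L[ℝ] ℝ} (hθ : ContDiff ℝ ∞ θ)
    {U : Set X} (hU : IsOpen U) {v : X} (hv : ∀ x ∈ U, θ x v = 1) {x : X} (hx : x ∈ U) (a : X) :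
    fderiv ℝ θ x a v = 0 := by
  have h1 : HasFDerivAt (fun z => θ z v) ((fderiv ℝ θ x).flip v) x := by
    simpa using (hθ.differentiable (by simp) x).hasFDerivAt.clm_apply (hasFDerivAt_const v x)
  have h2 : (fun z => θ z v) =ᶠ[𝓝 x] fun _ => 1 := by
    filter_upwards [hU.mem_nhds hx] with z hz using hv z hz
  have h3 := (h1.congr_of_eventuallyEq h2.symm).unique (hasFDerivAt_const (1 : ℝ) x)
  simpa using DFunLike.congr_fun h3 a

/-- Along a curve tangent to the kernel of an integrable covector field `θ`, a variation of the
curve through such curves that starts in the kernel stays in the kernel. -/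
theorem variation_endpoint_eq_zero {θ : X → X →L[ℝ] ℝ} (hθ : ContDiff ℝ ∞ θ)
    {U : Set X} (hU : IsOpen U) {v : X} (hv : ∀ x ∈ U, θ x v = 1)
    (hint : ∀ x ∈ U, ∀ h k, θ x h = 0 → θ x k = 0 → fderiv ℝ θ x h k = fderiv ℝ θ x k h)
    (x₀ y h : X) (β δ b d : C(I, ℝ)) (hβ : β = primitiveL b) (hδ : δ = primitiveL d)
    (hmem : ∀ s : I, x₀ + ((1 - (s : ℝ)) • y + β s • v) ∈ U)
    (hb : ∀ s : I, b s = θ (x₀ + ((1 - (s : ℝ)) • y + β s • v)) y)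
    (hd : ∀ s : I, d s = fderiv ℝ θ (x₀ + ((1 - (s : ℝ)) • y + β s • v))
      ((1 - (s : ℝ)) • h + δ s • v) y + θ (x₀ + ((1 - (s : ℝ)) • y + β s • v)) h)
    (hh : θ (x₀ + y) h = 0) : δ 1 = 0 := by
  set βe : ℝ → ℝ := fun t => ∫ s in (0 : ℝ)..t, IccExtend zero_le_one b s with hβe
  set δe : ℝ → ℝ := fun t => ∫ s in (0 : ℝ)..t, IccExtend zero_le_one d s with hδe
  have hβe' : ∀ s : I, βe s = β s := fun s => by rw [hβ]; rfl
  have hδe' : ∀ s : I, δe s = δ s := fun s => by rw [hδ]; rfl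
  have hsub : ∀ t : ℝ, HasDerivAt (fun t : ℝ => 1 - t) (-1) t := fun t => by
    simpa using (hasDerivAt_id t).const_sub 1
  set Γ : ℝ → X := fun t => x₀ + ((1 - t) • y + βe t • v) with hΓ
  set H : ℝ → X := fun t => (1 - t) • h + δe t • v with hH
  have hΓd : ∀ t, HasDerivAt Γ ((-1 : ℝ) • y + IccExtend zero_le_one b t • v) t := fun t =>
    (((hsub t).smul_const y).add ((hasDerivAt_integral_IccExtend b t).smul_const v)).const_add x₀
  have hHd : ∀ t, HasDerivAt H ((-1 : ℝ) • h + IccExtend zero_le_one d t • v) t := fun t =>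
    ((hsub t).smul_const h).add ((hasDerivAt_integral_IccExtend d t).smul_const v)
  have hθd : ∀ x, HasFDerivAt θ (fderiv ℝ θ x) x :=
    fun x => (hθ.differentiable (by simp) x).hasFDerivAt
  set r : ℝ → ℝ := fun t => θ (Γ t) (H t) with hr
  set m : ℝ → ℝ := fun t => fderiv ℝ θ (Γ t) v y with hm
  have hΓc : Continuous Γ := continuous_iff_continuousAt.2 fun t => (hΓd t).continuousAt
  have hmc : Continuous m := by
    have := (hθ.continuous_fderiv (by simp)).comp hΓc
    exact (this.clm_apply continuous_const).clm_apply continuous_const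
  have hrd : ∀ t, HasDerivAt r
      (fderiv ℝ θ (Γ t) ((-1 : ℝ) • y + IccExtend zero_le_one b t • v) (H t) +
        θ (Γ t) ((-1 : ℝ) • h + IccExtend zero_le_one d t • v)) t := fun t =>
    ((hθd (Γ t)).comp_hasDerivAt t (hΓd t)).clm_apply (hHd t)
  have hlin : ∀ t ∈ Icc (0 : ℝ) 1, HasDerivAt r (m t * r t) t := by
    intro t ht
    convert hrd t using 1
    have hΓU : Γ t ∈ U := by simpa [hΓ, hβe' ⟨t, ht⟩] using hmem ⟨t, ht⟩
    have hbt : IccExtend zero_le_one b t = θ (Γ t) y := by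
      rw [IccExtend_of_mem _ _ ht, hb ⟨t, ht⟩, ← hβe']
    have hdt : IccExtend zero_le_one d t = fderiv ℝ θ (Γ t) (H t) y + θ (Γ t) h := by
      rw [IccExtend_of_mem _ _ ht, hd ⟨t, ht⟩, ← hβe', ← hδe']
    have hv0 := fderiv_apply_eq_zero_of_apply_eq_one hθ hU hv hΓU
    have hv1 := hv _ hΓU
    have key := hint (Γ t) hΓU ((-1 : ℝ) • y + IccExtend zero_le_one b t • v) (H t - r t • v)
      (by simp [hbt, hv1]) (by simp [hr, hv1])
    simp only [map_add, map_sub, map_smul, smul_eq_mul, add_apply,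
      sub_apply, smul_apply, hv0, hv1, hdt] at key ⊢
    simp only [hm]
    linarith
  obtain ⟨K, hK⟩ := isCompact_Icc.exists_bound_of_continuousOn (s := Icc (0 : ℝ) 1)
    hmc.continuousOn
  have hr0 : r 0 = 0 := by simp [hr, hΓ, hH, hβe, hδe, hh]
  have hr1 := eq_zero_of_abs_deriv_le_mul_abs_self_of_eq_zero_right (f := r)
    (f' := fun t => m t * r t) (K := K) (a := 0) (b := 1)
    (fun t ht => (hlin t ht).continuousAt.continuousWithinAt)
    (fun t ht => (hlin t (Ico_subset_Icc_self ht)).hasDerivWithinAt) hr0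
    (fun t ht => by
      rw [norm_mul]
      exact mul_le_mul_of_nonneg_right (hK t (Ico_subset_Icc_self ht)) (norm_nonneg _))
    1 (right_mem_Icc.2 zero_le_one)
  have hU1 := hmem 1
  have hδ1 := hδe' 1
  have hβ1 := hβe' 1
  simp only [Icc.coe_one, sub_self, zero_smul, zero_add] at hU1 hδ1 hβ1
  simpa [hr, hΓ, hH, hβ1, hδ1, hv _ hU1] using hr1

/-- The curve `t ↦ (1 - t) • y + β t • v`, paired with the constant `y`. -/
def curveL (v : X) : X × C(I, ℝ) →L[ℝ] C(I, X × X) where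
  toFun z := ⟨fun t => ((1 - (t : ℝ)) • z.1 + z.2 t • v, z.1), by fun_prop⟩
  map_add' z w := by
    ext t
    · simp [add_smul, smul_add]; abel
    · simp
  map_smul' c z := by
    ext t
    · simp [smul_smul, mul_comm]
    · simp
  cont := ContinuousMap.continuous_of_continuous_uncurry _ (by
    simp only [Function.uncurry_def, ContinuousMap.coe_mk]
    fun_prop)

theorem curveL_apply (v : X) (z : X × C(I, ℝ)) (t : I) :
    curveL v z t = ((1 - (t : ℝ)) • z.1 + z.2 t • v, z.1) := rfl

/-- The **Frobenius theorem** for a covector field normalized by `θ v = 1`. -/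
theorem exists_smooth_first_integral_of_normalized [CompleteSpace X] {θ : X → X →L[ℝ] ℝ}
    (hθ : ContDiff ℝ ∞ θ) {U : Set X} (hU : IsOpen U) {v : X} (hv : ∀ x ∈ U, θ x v = 1)
    (hint : ∀ x ∈ U, ∀ h k, θ x h = 0 → θ x k = 0 → fderiv ℝ θ x h k = fderiv ℝ θ x k h)
    {x₀ : X} (hx₀ : x₀ ∈ U) :
    ∃ (q : X → ℝ) (Ω' : Set X), IsOpen Ω' ∧ x₀ ∈ Ω' ∧ Ω' ⊆ U ∧ ContDiffOn ℝ ∞ q Ω' ∧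
      ∀ x ∈ Ω', fderiv ℝ q x v ≠ 0 ∧ fderiv ℝ q x = fderiv ℝ q x v • θ x := by
  have hg : ContDiff ℝ ∞ (fun z : X × X => θ (x₀ + z.1) z.2) :=
    (hθ.comp (contDiff_const.add contDiff_fst)).clm_apply contDiff_snd
  set g : C(X × X, ℝ) := ⟨fun z => θ (x₀ + z.1) z.2, hg.continuous⟩
  have hgd : ∀ z, HasFDerivAt g (fderiv ℝ g z) z :=
    fun z => (hg.differentiable (by simp) z).hasFDerivAt
  have hgd' : ∀ z w : X × X, fderiv ℝ g z w =
      fderiv ℝ θ (x₀ + z.1) w.1 z.2 + θ (x₀ + z.1) w.2 := by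
    intro z w
    have h1 : HasFDerivAt (fun z : X × X => θ (x₀ + z.1))
        ((fderiv ℝ θ (x₀ + z.1)).comp (ContinuousLinearMap.fst ℝ X X)) z :=
      HasFDerivAt.comp z (hθ.differentiable (by simp) _).hasFDerivAt
        (hasFDerivAt_fst.const_add x₀)
    have h2 : HasFDerivAt g _ z := h1.clm_apply (hasFDerivAt_snd (p := z))
    rw [h2.fderiv]
    simp [add_comm]
  let g' : C(X × X, X × X →L[ℝ] ℝ) := ⟨fderiv ℝ g, hg.continuous_fderiv (by simp)⟩
  have hN : ContDiff ℝ ∞ (fun α : C(I, X × X) => g.comp α) := contDiff_postcomp g hg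
  obtain ⟨B, U₀, hU₀, h0U₀, hB, hB0, hBeq⟩ := exists_contDiffOn_implicit
    (fun z : X × C(I, ℝ) => z.2 - primitiveL (g.comp (curveL v z)))
    (contDiff_snd.sub ((hN.comp (curveL v).contDiff).continuousLinearMap_comp primitiveL))
    (fun β => by
      have : g.comp (curveL v (0, β)) = 0 := by
        ext t
        simp [g, curveL_apply]
      simp [this])
  have hBeq' : ∀ y ∈ U₀, B y = primitiveL (g.comp (curveL v (y, B y))) :=
    fun y hy => sub_eq_zero.1 (hBeq y hy)
  let O : Set C(I, X × X) := {α | MapsTo α univ {z | x₀ + z.1 ∈ U}}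
  have hO : IsOpen O := ContinuousMap.isOpen_setOfPred_mapsTo isCompact_univ
    (hU.preimage (by fun_prop))
  set U₁ : Set X := U₀ ∩ (fun y => curveL v (y, B y)) ⁻¹' O
  have hU₁ : IsOpen U₁ := ContinuousOn.isOpen_inter_preimage
    ((curveL v).continuous.comp_continuousOn (continuousOn_id.prodMk hB.continuousOn)) hU₀ hO
  have h0U₁ : (0 : X) ∈ U₁ := by
    refine ⟨h0U₀, fun t _ => ?_⟩
    simpa [curveL_apply, hB0] using hx₀
  have hcurve : ∀ y ∈ U₁, ∀ s : I, x₀ + ((1 - (s : ℝ)) • y + B y s • v) ∈ U :=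
    fun y hy s => hy.2 (mem_univ s)
  have hB' : ∀ y ∈ U₁, HasFDerivAt B (fderiv ℝ B y) y := fun y hy =>
    ((hB.contDiffAt (hU₀.mem_nhds hy.1)).differentiableAt (by simp)).hasFDerivAt
  have hDB : ∀ y ∈ U₁, ∀ h, fderiv ℝ B y h = primitiveL
      (pointwiseApplyL I (g'.comp (curveL v (y, B y))) (curveL v (h, fderiv ℝ B y h))) := by
    intro y hy h
    have h1 : HasFDerivAt (fun y => (y, B y))
        ((ContinuousLinearMap.id ℝ X).prod (fderiv ℝ B y)) y :=
      (hasFDerivAt_id y).prodMk (hB' y hy)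
    have h2 := ((curveL v).hasFDerivAt (x := (y, B y))).comp y h1
    have h3 := (hasFDerivAt_postcomp g g' hgd (curveL v (y, B y))).comp y h2
    have h4 := (primitiveL.hasFDerivAt (x := g.comp (curveL v (y, B y)))).comp y h3
    have h5 : B =ᶠ[𝓝 y] fun y => primitiveL (g.comp (curveL v (y, B y))) := by
      filter_upwards [hU₀.mem_nhds hy.1] with z hz using hBeq' z hz
    exact DFunLike.congr_fun ((hB' y hy).unique (h4.congr_of_eventuallyEq h5)) h
  have hker : ∀ y ∈ U₁, ∀ h, θ (x₀ + y) h = 0 → fderiv ℝ B y h 1 = 0 := by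
    intro y hy h hh
    refine variation_endpoint_eq_zero hθ hU hv hint x₀ y h (B y) (fderiv ℝ B y h) _ _
      (hBeq' y hy.1) (hDB y hy h) (hcurve y hy) (fun s => rfl) (fun s => ?_) hh
    exact hgd' _ _
  have hB0v : fderiv ℝ B 0 v 1 = 1 := by
    rw [hDB 0 h0U₁ v]
    have : pointwiseApplyL I (g'.comp (curveL v (0, B 0))) (curveL v (v, fderiv ℝ B 0 v)) = 1 := by
      ext s
      refine (hgd' _ _).trans ?_
      simpa [curveL_apply, hB0] using hv _ hx₀
    rw [this, primitiveL_apply]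
    simp [IccExtend]
  let ev : C(I, ℝ) →L[ℝ] ℝ := ContinuousMap.evalCLM ℝ (1 : I)
  let q : X → ℝ := fun x => ev (B (x - x₀))
  have hqB : ∀ x, x - x₀ ∈ U₁ → ∀ h, fderiv ℝ q x h = fderiv ℝ B (x - x₀) h 1 := by
    intro x hx h
    have h1 : HasFDerivAt (fun x => B (x - x₀)) _ x :=
      (hB' _ hx).comp x ((hasFDerivAt_id x).sub_const x₀)
    have h2 : HasFDerivAt q _ x := ev.hasFDerivAt.comp x h1
    rw [h2.fderiv]
    rfl
  have hU₂ : IsOpen ((fun x => x - x₀) ⁻¹' U₁) := hU₁.preimage (by fun_prop)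
  have hq : ContDiffOn ℝ ∞ q ((fun x => x - x₀) ⁻¹' U₁) :=
    ((hB.mono inter_subset_left).comp (contDiff_id.sub contDiff_const).contDiffOn
      (fun x (hx : x - x₀ ∈ U₁) => hx)).continuousLinearMap_comp ev
  have hqv : ContinuousOn (fun x => fderiv ℝ q x v) ((fun x => x - x₀) ⁻¹' U₁) :=
    (hq.continuousOn_fderiv_of_isOpen hU₂ (by simp)).clm_apply continuousOn_const
  have hxU : ∀ x, x - x₀ ∈ U₁ → x ∈ U := by
    intro x hx
    have h1 := hcurve _ hx 0
    have h2 : B (x - x₀) 0 = 0 := by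
      rw [hBeq' _ hx.1, primitiveL_apply]
      simp
    simpa [h2] using h1
  refine ⟨q, _, hqv.isOpen_inter_preimage hU₂ isOpen_ne, ⟨?_, ?_⟩, ?_,
    hq.mono inter_subset_left, fun x hx => ⟨hx.2, ?_⟩⟩
  · simpa using h0U₁
  · change fderiv ℝ q x₀ v ≠ 0
    rw [hqB x₀ (by simpa using h0U₁), sub_self, hB0v]
    exact one_ne_zero
  · exact fun x hx => hxU x hx.1
  · have hx1 := hv x (hxU x hx.1)
    ext h
    have h1 := hker _ hx.1 (h - θ x h • v) (by simp [hx1])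
    rw [map_sub, map_smul] at h1
    simp only [ContinuousMap.sub_apply, ContinuousMap.smul_apply, smul_eq_mul,
      ← hqB x hx.1] at h1
    simp only [smul_apply, smul_eq_mul]
    linarith

/-- The **Frobenius theorem** for covector fields: if `θ ∧ dθ = 0` and `θ x₀ ≠ 0`, then
`θ = p • dq` near `x₀`. -/
theorem exists_eq_smul_fderiv_of_wedge_eq_zero [FiniteDimensional ℝ X] {θ : X → X →L[ℝ] ℝ}
    {Ω : Set X} (hΩ : IsOpen Ω) (hθ : ContDiffOn ℝ ∞ θ Ω)
    (hint : ∀ x ∈ Ω, ∀ h k l, θ x h * (fderiv ℝ θ x k l - fderiv ℝ θ x l k) +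
      θ x k * (fderiv ℝ θ x l h - fderiv ℝ θ x h l) +
      θ x l * (fderiv ℝ θ x h k - fderiv ℝ θ x k h) = 0)
    {x₀ : X} (hx₀ : x₀ ∈ Ω) (hne : θ x₀ ≠ 0) :
    ∃ (Ω' : Set X) (p q : X → ℝ), Ω' ⊆ Ω ∧ IsOpen Ω' ∧ x₀ ∈ Ω' ∧ ContDiffOn ℝ ∞ p Ω' ∧
      ContDiffOn ℝ ∞ q Ω' ∧ ∀ x ∈ Ω', θ x = p x • fderiv ℝ q x := by
  have : CompleteSpace X := FiniteDimensional.complete ℝ X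
  obtain ⟨v, hv⟩ : ∃ v, θ x₀ v ≠ 0 := by
    by_contra! h
    exact hne (ContinuousLinearMap.ext h)
  have hθv : ContDiffOn ℝ ∞ (fun x => θ x v) Ω := hθ.clm_apply contDiffOn_const
  set Ω₁ : Set X := Ω ∩ (fun x => θ x v) ⁻¹' {c | c ≠ 0}
  have hΩ₁ : IsOpen Ω₁ := hθv.continuousOn.isOpen_inter_preimage hΩ isOpen_ne
  have hθ₁ : ContDiffOn ℝ ∞ (fun x => (θ x v)⁻¹ • θ x) Ω₁ :=
    ((hθv.mono inter_subset_left).inv fun x hx => hx.2).smul (hθ.mono inter_subset_left)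
  obtain ⟨ε, hε, hball⟩ := Metric.isOpen_iff.1 hΩ₁ x₀ ⟨hx₀, hv⟩
  let χ : ContDiffBump x₀ := ⟨ε / 4, ε / 2, by positivity, by linarith⟩
  have hχ : tsupport χ ⊆ Ω₁ := by
    rw [χ.tsupport_eq]
    exact (Metric.closedBall_subset_ball (by change ε / 2 < ε; linarith)).trans hball
  set η : X → X →L[ℝ] ℝ := fun x => χ x • (θ x v)⁻¹ • θ x with hη
  have hηs : ContDiff ℝ ∞ η := by
    refine contDiff_iff_contDiffAt.2 fun x => ?_
    by_cases hx : x ∈ tsupport χ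
    · exact χ.contDiff.contDiffAt.smul (hθ₁.contDiffAt (hΩ₁.mem_nhds (hχ hx)))
    · refine (contDiffAt_const (c := 0)).congr_of_eventuallyEq ?_
      filter_upwards [notMem_tsupport_iff_eventuallyEq.1 hx] with z hz
      simp [hη, hz]
  set U : Set X := Metric.ball x₀ (ε / 4)
  have hUΩ : U ⊆ Ω₁ := (Metric.ball_subset_ball (by linarith)).trans hball
  have hηU : ∀ x ∈ U, η x = (θ x v)⁻¹ • θ x := by
    intro x hx
    have : χ x = 1 := χ.one_of_mem_closedBall (Metric.ball_subset_closedBall hx)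
    simp [hη, this]
  have hη1 : ∀ x ∈ U, η x v = 1 := by
    intro x hx
    rw [hηU x hx]
    exact inv_mul_cancel₀ (hUΩ hx).2
  have hηint : ∀ x ∈ U, ∀ h k, η x h = 0 → η x k = 0 →
      fderiv ℝ η x h k = fderiv ℝ η x k h := by
    intro x hx h k hh hk
    have hxv : θ x v ≠ 0 := (hUΩ hx).2
    have hxΩ : Ω ∈ 𝓝 x := hΩ.mem_nhds (hUΩ hx).1
    have hη' : η =ᶠ[𝓝 x] fun x => (θ x v)⁻¹ • θ x := by
      filter_upwards [Metric.isOpen_ball.mem_nhds hx] with z hz using hηU z hz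
    have hc : DifferentiableAt ℝ (fun x => (θ x v)⁻¹) x :=
      ((hθv.contDiffAt hxΩ).differentiableAt (by simp)).inv hxv
    have hθx : DifferentiableAt ℝ θ x := (hθ.contDiffAt hxΩ).differentiableAt (by simp)
    rw [hηU x hx, smul_apply, smul_eq_mul, mul_eq_zero, or_iff_right (inv_ne_zero hxv)] at hh hk
    have hw := hint x (hUΩ hx).1 h k v
    rw [hh, hk, zero_mul, zero_mul, zero_add, zero_add, mul_eq_zero, or_iff_right hxv,
      sub_eq_zero] at hw
    have hη'' := (hc.hasFDerivAt.smul hθx.hasFDerivAt).congr_of_eventuallyEq hη'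
    rw [hη''.fderiv]
    simp [hh, hk, hw]
  obtain ⟨q, Ω', hΩ', hx₀', hΩ'U, hq, hq'⟩ := exists_smooth_first_integral_of_normalized hηs
    Metric.isOpen_ball hη1 hηint (Metric.mem_ball_self (by positivity))
  have hΩ'Ω : Ω' ⊆ Ω := fun x hx => (hUΩ (hΩ'U hx)).1
  refine ⟨Ω', fun x => θ x v / fderiv ℝ q x v, q, hΩ'Ω, hΩ', hx₀', ?_, hq, fun x hx => ?_⟩
  · exact (hθv.mono hΩ'Ω).div ((hq.fderiv_of_isOpen hΩ' le_rfl).clm_apply contDiffOn_const)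
      fun x hx => (hq' x hx).1
  · obtain ⟨h1, h2⟩ := hq' x hx
    have hxv : θ x v ≠ 0 := (hUΩ (hΩ'U hx)).2
    rw [h2, hηU x (hΩ'U hx), smul_smul, smul_smul]
    simp [h1, hxv]

end Frobenius

/-- The covector `⟨w, ·⟩`, as a continuous linear function of `w`. -/
def dotL : R3 →L[ℝ] R3 →L[ℝ] ℝ :=
  ∑ i, (ContinuousLinearMap.proj (R := ℝ) (φ := fun _ : Fin 3 => ℝ) i).smulRight
    (ContinuousLinearMap.proj (R := ℝ) (φ := fun _ : Fin 3 => ℝ) i)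

theorem dotL_apply (w h : R3) : dotL w h = ∑ i, w i * h i := by
  simp [dotL, sum_apply]

theorem fderiv_eq_sum_pd3 (f : R3 → ℝ) (x h : R3) : fderiv ℝ f x h = ∑ i, h i * pd3 i f x := by
  conv_lhs => rw [pi_eq_sum_univ' h, map_sum]
  simp [pd3]

theorem fderiv_eq_dotL_grad3 (f : R3 → ℝ) (x : R3) : fderiv ℝ f x = dotL (grad3 f x) := by
  ext1 h
  simp [fderiv_eq_sum_pd3, dotL_apply, grad3, mul_comm]

theorem dotL_injective : Function.Injective dotL := by
  intro v w h
  ext i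
  simpa [dotL_apply, Pi.single_apply] using DFunLike.congr_fun h (Pi.single i 1)

theorem fderiv_apply_eq_sum_pd3 {V : R3 → R3} {x : R3} (hV : DifferentiableAt ℝ V x) (h : R3)
    (i : Fin 3) : fderiv ℝ V x h i = ∑ j, h j * pd3 j (fun y => V y i) x := by
  rw [← fderiv_eq_sum_pd3, fderiv_apply hV]
  rfl

/-- Paper's Proposition 3: if the solenoidal part V − ∇φ of a flow is
helicity free on Ω, then near any point where V − ∇φ ≠ 0 the flow is epi-2D:
V = ∇φ + p·∇q. -/
theorem locally_epi2D (Ω : Set R3) (hΩ : IsOpen Ω)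
    (V : R3 → R3) (φ : R3 → ℝ)
    (hV : ContDiffOn ℝ (⊤ : ℕ∞) V Ω) (hφ : ContDiffOn ℝ (⊤ : ℕ∞) φ Ω)
    (hhel : ∀ x ∈ Ω, dot3 (V x - grad3 φ x) (curl3 V x) = 0)
    (x₀ : R3) (hx₀ : x₀ ∈ Ω) (hne : V x₀ - grad3 φ x₀ ≠ 0) :
    ∃ Ω' : Set R3, Ω' ⊆ Ω ∧ IsOpen Ω' ∧ x₀ ∈ Ω' ∧
      ∃ p q : R3 → ℝ, ContDiffOn ℝ (⊤ : ℕ∞) p Ω' ∧ ContDiffOn ℝ (⊤ : ℕ∞) q Ω' ∧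
        ∀ x ∈ Ω', V x = grad3 φ x + p x • grad3 q x := by
  set θ : R3 → R3 →L[ℝ] ℝ := fun x => dotL (V x) - fderiv ℝ φ x
  have hθW : ∀ x, θ x = dotL (V x - grad3 φ x) := fun x => by
    rw [map_sub, ← fderiv_eq_dotL_grad3]
  have hdφ : ContDiffOn ℝ ∞ (fderiv ℝ φ) Ω := hφ.fderiv_of_isOpen hΩ le_rfl
  have hθ : ContDiffOn ℝ ∞ θ Ω := (hV.continuousLinearMap_comp dotL).sub hdφ
  have hint : ∀ x ∈ Ω, ∀ h k l, θ x h * (fderiv ℝ θ x k l - fderiv ℝ θ x l k) +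
      θ x k * (fderiv ℝ θ x l h - fderiv ℝ θ x h l) +
      θ x l * (fderiv ℝ θ x h k - fderiv ℝ θ x k h) = 0 := by
    intro x hx h k l
    have hxΩ := hΩ.mem_nhds hx
    have hVx : DifferentiableAt ℝ V x := (hV.contDiffAt hxΩ).differentiableAt (by simp)
    have hDθ : fderiv ℝ θ x = dotL.comp (fderiv ℝ V x) - fderiv ℝ (fderiv ℝ φ) x :=
      ((dotL.hasFDerivAt.comp x hVx.hasFDerivAt).sub
        ((hdφ.contDiffAt hxΩ).differentiableAt (by simp)).hasFDerivAt).fderiv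
    have hsymm : IsSymmSndFDerivAt ℝ φ x := (hφ.contDiffAt hxΩ).isSymmSndFDerivAt (by
      rw [minSmoothness_of_isRCLikeNormedField]
      exact WithTop.coe_le_coe.2 (le_top : (2 : ℕ∞) ≤ ⊤))
    have hd : ∀ a b, fderiv ℝ θ x a b - fderiv ℝ θ x b a =
        dotL (fderiv ℝ V x a) b - dotL (fderiv ℝ V x b) a := by
      intro a b
      simp only [hDθ, sub_apply, ContinuousLinearMap.comp_apply, hsymm.eq a b]
      ring
    rw [hd, hd, hd, hθW]
    have hc := hhel x hx
    simp only [dot3, curl3, Fin.sum_univ_three, Matrix.cons_val_zero, Matrix.cons_val_one,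
      Matrix.cons_val] at hc
    simp only [dotL_apply, Fin.sum_univ_three, fderiv_apply_eq_sum_pd3 hVx]
    linear_combination (h 0 * (k 1 * l 2 - k 2 * l 1) - h 1 * (k 0 * l 2 - k 2 * l 0) +
      h 2 * (k 0 * l 1 - k 1 * l 0)) * hc
  have hθ₀ : θ x₀ ≠ 0 := by
    rw [hθW, ← map_zero dotL]
    exact dotL_injective.ne hne
  obtain ⟨Ω', p, q, hsub, hopen, hmem, hp, hq, h⟩ :=
    exists_eq_smul_fderiv_of_wedge_eq_zero hΩ hθ hint hx₀ hθ₀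
  refine ⟨Ω', hsub, hopen, hmem, p, q, hp, hq, fun x hx => ?_⟩
  rw [← sub_eq_iff_eq_add']
  apply dotL_injective
  rw [← hθW, h x hx, map_smul, ← fderiv_eq_dotL_grad3]
end
end
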